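/- Under assumptions (A1)-(A3), for any p ≥ 1 there exist constants c, β > 0 such that E‖X_t^ξ‖_∞^p ≤ c(1 + e^{−βt}‖ξ‖_∞^p) for all ξ ∈ 𝒞 and t ≥ 0. -/

import Mathlib

open MeasureTheory ProbabilityTheory Filter Set
open scoped RealInnerProductSpace ENNReal NNReal Topology

noncomputable section

/-- Euclidean state space `ℝ^d`. -/
abbrev EucSp (d : ℕ) := EuclideanSpace ℝ (Fin d)

/-- The path (segment) space `𝒞 = C([-r₀,0];ℝ^d)` with the uniform norm. -/
abbrev Seg (d : ℕ) (r₀ : ℝ) := C(Set.Icc (-r₀) (0:ℝ), EucSp d)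

instance (d : ℕ) (r₀ : ℝ) : MeasurableSpace (Seg d r₀) := borel _
instance (d : ℕ) (r₀ : ℝ) : BorelSpace (Seg d r₀) := ⟨rfl⟩

/-- Evaluation of a segment at time `0`. -/
def ev0 {d : ℕ} {r₀ : ℝ} (h : 0 < r₀) (ξ : Seg d r₀) : EucSp d :=
  ξ ⟨0, ⟨neg_nonpos.mpr h.le, le_rfl⟩⟩

/-- The setting of the path-dependent SDE `dX(t) = b(X_t)dt + σ(X_t)dW(t)` under
assumptions (A1) (continuity), (A2) (dissipativity) and (A3) (invertibility).
`Y ξ` is the real-time solution path started from the initial segment `ξ`, `X ξ t` is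
the associated segment (window) process, adapted to the filtration `ℱ`.  The SDE itself
is encoded through the Stroock–Varadhan martingale-problem formulation (`hSDE₁`,
`hSDE₂`), which characterizes (weak) solutions driven by a `d`-dimensional Brownian
motion, and `hMarkov` is the Markov (Chapman–Kolmogorov) property of the segment
process. -/
structure PathSDE (d : ℕ) (r₀ : ℝ) (Ω : Type) [mΩ : MeasurableSpace Ω]
    (P : Measure Ω) where
  hr₀ : 0 < r₀
  hP : IsProbabilityMeasure P
  b : Seg d r₀ → EucSp d
  σ : Seg d r₀ → (EucSp d →L[ℝ] EucSp d)
  ℱ : Filtration ℝ mΩ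
  Y : Seg d r₀ → Ω → ℝ → EucSp d
  X : Seg d r₀ → ℝ → Ω → Seg d r₀
  hYcont : ∀ ξ ω, Continuous (Y ξ ω)
  hY0 : ∀ (ξ : Seg d r₀) (ω : Ω) (θ : Set.Icc (-r₀) (0:ℝ)), Y ξ ω θ.1 = ξ θ
  hX : ∀ (ξ : Seg d r₀), ∀ t ≥ (0:ℝ), ∀ (ω : Ω) (θ : Set.Icc (-r₀) (0:ℝ)),
    X ξ t ω θ = Y ξ ω (t + θ.1)
  hXadapted : ∀ (ξ : Seg d r₀), ∀ t ≥ (0:ℝ),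
    @MeasureTheory.StronglyMeasurable Ω (Seg d r₀) _ (ℱ t) (X ξ t)
  -- (A1) continuity assumptions
  hA1σ : ∃ L : ℝ≥0, LipschitzWith L σ
  hA1bcont : Continuous b
  hA1bbdd : ∀ R : ℝ, ∃ C : ℝ, ∀ ξ : Seg d r₀, ‖ξ‖ ≤ R → ‖b ξ‖ ≤ C
  -- (A2) dissipativity
  hA2 : ∃ l₁ l₂ : ℝ, 0 < l₁ ∧ 0 < l₂ ∧ l₂ * Real.exp (l₁ * r₀) < l₁ ∧
    ∀ ξ η : Seg d r₀,
      2 * ⟪ev0 hr₀ ξ - ev0 hr₀ η, b ξ - b η⟫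
        ≤ -l₁ * ‖ev0 hr₀ ξ - ev0 hr₀ η‖ ^ 2 + l₂ * ‖ξ - η‖ ^ 2
  -- (A3) invertibility and boundedness of σ
  σinv : Seg d r₀ → (EucSp d →L[ℝ] EucSp d)
  hσinv : ∀ ξ, (σ ξ).comp (σinv ξ) = ContinuousLinearMap.id ℝ (EucSp d) ∧
      (σinv ξ).comp (σ ξ) = ContinuousLinearMap.id ℝ (EucSp d)
  hA3 : ∃ C : ℝ, ∀ ξ, ‖σ ξ‖ + ‖σinv ξ‖ ≤ C
  -- martingale problem formulation of the SDE (weak solution)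
  hSDE₁ : ∀ (ξ : Seg d r₀) (u : EucSp d),
    Martingale (fun t ω =>
      ⟪u, Y ξ ω (max t 0)⟫ - ⟪u, ev0 hr₀ ξ⟫
        - ∫ s in (0:ℝ)..(max t 0), ⟪u, b (X ξ s ω)⟫) ℱ P
  hSDE₂ : ∀ (ξ : Seg d r₀) (u v : EucSp d),
    Martingale (fun t ω =>
      (⟪u, Y ξ ω (max t 0)⟫ - ⟪u, ev0 hr₀ ξ⟫
        - ∫ s in (0:ℝ)..(max t 0), ⟪u, b (X ξ s ω)⟫) *
      (⟪v, Y ξ ω (max t 0)⟫ - ⟪v, ev0 hr₀ ξ⟫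
        - ∫ s in (0:ℝ)..(max t 0), ⟪v, b (X ξ s ω)⟫)
      - ∫ s in (0:ℝ)..(max t 0),
          ⟪(ContinuousLinearMap.adjoint (σ (X ξ s ω))) u,
            (ContinuousLinearMap.adjoint (σ (X ξ s ω))) v⟫) ℱ P
  -- Markov property (Chapman–Kolmogorov) of the segment process
  hMarkov : ∀ (f : Seg d r₀ → ℝ), Measurable f → (∃ C, ∀ ζ, |f ζ| ≤ C) →
    ∀ s ≥ (0:ℝ), ∀ t ≥ (0:ℝ), ∀ ξ,
      (∫ ω, f (X ξ (s + t) ω) ∂P) = ∫ ω, ∫ ω', f (X (X ξ s ω) t ω') ∂P ∂P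

variable {d : ℕ} {r₀ : ℝ} {Ω : Type} [mΩ : MeasurableSpace Ω] {P : Measure Ω}

/-- The Markov semigroup `P_t f(ξ) = E f(X_t^ξ)`. -/
def PathSDE.Pt (S : PathSDE d r₀ Ω P) (t : ℝ) (f : Seg d r₀ → ℝ) (ξ : Seg d r₀) : ℝ :=
  ∫ ω, f (S.X ξ t ω) ∂P

/-- `μ` is an invariant probability measure of the semigroup `P_t`. -/
def PathSDE.Invariant (S : PathSDE d r₀ Ω P) (μ : Measure (Seg d r₀)) : Prop :=
  IsProbabilityMeasure μ ∧
  ∀ (f : Seg d r₀ → ℝ), Measurable f → (∃ C, ∀ ζ, |f ζ| ≤ C) →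
    ∀ t ≥ (0:ℝ), ∫ ξ, S.Pt t f ξ ∂μ = ∫ ξ, f ξ ∂μ

/-- The quasi-metric `ρ_{p,γ}(ξ,η) = (1 ∧ ‖ξ-η‖_∞^γ) √(1+‖ξ‖_∞^p+‖η‖_∞^p)`. -/
def qdist (p γ : ℝ) (ξ η : Seg d r₀) : ℝ :=
  min 1 (‖ξ - η‖ ^ γ) * Real.sqrt (1 + ‖ξ‖ ^ p + ‖η‖ ^ p)

/-- The norm `‖f‖_{p,γ}` on the class `C_{p,γ}(𝒞)` (with the convention `x/0 = 0`,
so that the diagonal does not contribute to the second supremum). -/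
def pgNorm (p γ : ℝ) (f : Seg d r₀ → ℝ) : ℝ :=
  (⨆ ξ : Seg d r₀, |f ξ| / (1 + ‖ξ‖ ^ (p / 2))) +
  ⨆ q : Seg d r₀ × Seg d r₀, |f q.1 - f q.2| / qdist p γ q.1 q.2

/-- Membership in the class `C_{p,γ}(𝒞)`: continuity together with finiteness of the
two suprema defining `‖f‖_{p,γ}`. -/
def MemCpg (p γ : ℝ) (f : Seg d r₀ → ℝ) : Prop :=
  Continuous f ∧
  BddAbove (Set.range fun ξ : Seg d r₀ => |f ξ| / (1 + ‖ξ‖ ^ (p / 2))) ∧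
  BddAbove (Set.range fun q : Seg d r₀ × Seg d r₀ => |f q.1 - f q.2| / qdist p γ q.1 q.2)

/-- The additive functional `A_t^f(ξ) = (1/t)∫₀^t f(X_s^ξ) ds`. -/
def timeAvg (S : PathSDE d r₀ Ω P) (f : Seg d r₀ → ℝ) (ξ : Seg d r₀) (t : ℝ) (ω : Ω) : ℝ :=
  (∫ s in (0:ℝ)..t, f (S.X ξ s ω)) / t

/-- `π` is a coupling of `μ` and `ν`. -/
def IsCoupling (μ ν : Measure (Seg d r₀)) (π : Measure (Seg d r₀ × Seg d r₀)) : Prop :=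
  π.map Prod.fst = μ ∧ π.map Prod.snd = ν

/-- Membership in `𝒫_{p,γ}(𝒞)`: probability measures with `(μ×μ)(ρ_{p,γ}) < ∞`. -/
def MemPpg (p γ : ℝ) (μ : Measure (Seg d r₀)) : Prop :=
  IsProbabilityMeasure μ ∧
    Integrable (fun q : Seg d r₀ × Seg d r₀ => qdist p γ q.1 q.2) (μ.prod μ)

/-- The Wasserstein "distance" `W_{p,γ}` associated with the quasi-metric `ρ_{p,γ}`. -/
def Wpg (p γ : ℝ) (μ ν : Measure (Seg d r₀)) : ℝ :=
  sInf {r : ℝ | ∃ π : Measure (Seg d r₀ × Seg d r₀),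
    IsCoupling μ ν π ∧ r = ∫ q, qdist p γ q.1 q.2 ∂π}

/-- `μ P_t`: the law of the segment `X_t` when `X_0` is distributed as `μ`. -/
def PathSDE.lawAt (S : PathSDE d r₀ Ω P) (μ : Measure (Seg d r₀)) (t : ℝ) :
    Measure (Seg d r₀) :=
  μ.bind fun ξ => P.map (S.X ξ t)

/-- The corrector `R_f(ξ) = ∫₀^∞ {P_t f(ξ) − μ∞(f)} dt`. -/
def Rcorr (S : PathSDE d r₀ Ω P) (μinf : Measure (Seg d r₀)) (f : Seg d r₀ → ℝ)
    (ξ : Seg d r₀) : ℝ :=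
  ∫ t in Set.Ioi (0:ℝ), (S.Pt t f ξ - ∫ η, f η ∂μinf)

/-- `φ_f(ξ) = E|∫₀¹ f(X_r^ξ)dr + R_f(X_1^ξ) − R_f(ξ)|²`. -/
def phiF (S : PathSDE d r₀ Ω P) (μinf : Measure (Seg d r₀)) (f : Seg d r₀ → ℝ)
    (ξ : Seg d r₀) : ℝ :=
  ∫ ω, ((∫ r in (0:ℝ)..1, f (S.X ξ r ω))
      + Rcorr S μinf f (S.X ξ 1 ω) - Rcorr S μinf f ξ) ^ 2 ∂P

/-- `D_f = √(μ∞(φ_f))`. -/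
def DF (S : PathSDE d r₀ Ω P) (μinf : Measure (Seg d r₀)) (f : Seg d r₀ → ℝ) : ℝ :=
  Real.sqrt (∫ ξ, phiF S μinf f ξ ∂μinf)

/-- `Φ_D`: distribution function of the centered normal law with variance `D`
(`Φ_0 = 1_{[0,∞)}`). -/
def PhiD (D : ℝ) (z : ℝ) : ℝ :=
  if D = 0 then (if 0 ≤ z then 1 else 0)
  else (gaussianReal 0 D.toNNReal (Set.Iic z)).toReal

/-- `R̂_f(ξ) = Σ_{k=0}^∞ P_k f(ξ)` (discrete corrector, for `μ∞(f) = 0`). -/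
def Rhat (S : PathSDE d r₀ Ω P) (f : Seg d r₀ → ℝ) (ξ : Seg d r₀) : ℝ :=
  ∑' k : ℕ, S.Pt (k : ℝ) f ξ

/-- `φ̂_f(ξ) = E|f(ξ) + R̂_f(X_1^ξ) − R̂_f(ξ)|²`. -/
def phiHat (S : PathSDE d r₀ Ω P) (f : Seg d r₀ → ℝ) (ξ : Seg d r₀) : ℝ :=
  ∫ ω, (f ξ + Rhat S f (S.X ξ 1 ω) - Rhat S f ξ) ^ 2 ∂P

/-- `D̂_f = √(μ∞(φ̂_f))`. -/
def Dhat (S : PathSDE d r₀ Ω P) (μinf : Measure (Seg d r₀)) (f : Seg d r₀ → ℝ) : ℝ :=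
  Real.sqrt (∫ ξ, phiHat S f ξ ∂μinf)

section ScalarPaths

/-- The last time before `t` at which a continuous path is at level `a`. -/
theorem exists_last_exit {g : ℝ → ℝ} (hg : Continuous g) {s t a : ℝ} (hst : s ≤ t)
    (hs : g s ≤ a) (ht : a ≤ g t) :
    ∃ r ∈ Icc s t, g r = a ∧ ∀ q ∈ Icc r t, a ≤ g q := by
  have hK : IsCompact (Icc s t ∩ g ⁻¹' Iic a) :=
    isCompact_Icc.inter_right (isClosed_Iic.preimage hg)
  obtain ⟨r, ⟨hr, hra⟩, hmax⟩ := hK.exists_isGreatest ⟨s, ⟨le_rfl, hst⟩, hs⟩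
  have hra' : g r ≤ a := hra
  obtain ⟨q, hq, hqa⟩ := intermediate_value_Icc hr.2 hg.continuousOn ⟨hra', ht⟩
  have hqr : q ≤ r := hmax ⟨⟨hr.1.trans hq.1, hq.2⟩, hqa.le⟩
  obtain rfl : q = r := le_antisymm hqr hq.1
  refine ⟨q, hr, hqa, fun x hx => ?_⟩
  by_contra! hlt
  have hxq : x ≤ q := hmax ⟨⟨hr.1.trans hx.1, hx.2⟩, hlt.le⟩
  obtain rfl : x = q := le_antisymm hxq hx.1
  exact hlt.ne hqa

/-- The first time after `s` at which a continuous path reaches level `a`. -/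
theorem exists_first_hit {g : ℝ → ℝ} (hg : Continuous g) {s t a : ℝ} (hst : s ≤ t)
    (hs : g s ≤ a) (ht : a ≤ g t) :
    ∃ r ∈ Icc s t, g r = a ∧ ∀ q ∈ Icc s r, g q ≤ a := by
  obtain ⟨r, hr, hra, hq⟩ := exists_last_exit (g := fun q => -g (-q)) (by fun_prop)
    (s := -t) (t := -s) (a := -a) (by linarith) (by simpa using ht) (by simpa using hs)
  refine ⟨-r, ⟨by linarith [hr.2], by linarith [hr.1]⟩, by linarith, fun q hqm => ?_⟩
  have := hq (-q) ⟨by linarith [hqm.2], by linarith [hqm.1]⟩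
  simp only [neg_neg] at this
  linarith

theorem intervalIntegral_le_const_mul {f : ℝ → ℝ} (hf : Continuous f) {s t C : ℝ} (hst : s ≤ t)
    (h : ∀ r ∈ Icc s t, f r ≤ C) : ∫ r in s..t, f r ≤ (t - s) * C := by
  have := intervalIntegral.integral_mono_on hst (hf.intervalIntegrable s t)
    (continuous_const.intervalIntegrable (μ := volume) s t) h
  simpa using this

/-- A path whose drift is nonpositive above level `ρ L`, as long as the history stays below `L`,
cannot reach `L` if its fluctuations are smaller than `(1 - ρ) L`. -/
theorem stays_below_of_drift_nonpos {g f : ℝ → ℝ} (hg : Continuous g) (hf : Continuous f)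
    {T r₀ L ρ δ : ℝ} (hr₀ : 0 ≤ r₀) (hρL : ρ * L < L) (hδ : δ < L - ρ * L)
    (hE : ∀ s t, 0 ≤ s → s ≤ t → t ≤ T → (∀ r ∈ Icc s t, ρ * L ≤ g r ∧ g r ≤ L) →
      g t ≤ g s + (∫ r in s..t, f r) + δ)
    (hdrift : ∀ r ∈ Icc 0 T, (∀ q ∈ Icc (r - r₀) r, g q ≤ L) → ρ * L ≤ g r → f r ≤ 0)
    (h0 : ∀ q ∈ Icc (-r₀) 0, g q ≤ ρ * L) :
    ∀ r ∈ Icc 0 T, g r < L := by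
  intro r hr
  by_contra! hL
  have hg0 : g 0 ≤ ρ * L := h0 0 ⟨by linarith, le_rfl⟩
  obtain ⟨t, ht, htL, hbelow⟩ := exists_first_hit hg hr.1 (by linarith) hL
  obtain ⟨s, hs, hsL, habove⟩ := exists_last_exit hg ht.1 hg0 (by linarith)
  have hhist : ∀ q ∈ Icc (-r₀) t, g q ≤ L := fun q hq => by
    rcases le_total q 0 with h | h
    · linarith [h0 q ⟨hq.1, h⟩]
    · exact hbelow q ⟨h, hq.2⟩
  have h1 := hE s t hs.1 hs.2 (ht.2.trans hr.2) fun q hq =>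
    ⟨habove q hq, hhist q ⟨by linarith [hs.1, hq.1], hq.2⟩⟩
  have h2 : ∫ q in s..t, f q ≤ (t - s) * 0 := intervalIntegral_le_const_mul hf hs.2 fun q hq =>
    hdrift q ⟨hs.1.trans hq.1, (hq.2.trans ht.2).trans hr.2⟩
      (fun x hx => hhist x ⟨by linarith [hs.1, hq.1, hx.1], hx.2.trans hq.2⟩) (habove q hq)
  linarith

/-- One relaxation step: if the history is below `B`, then after a time `τ` the path is below
`(ρ + ε) B + δ`. -/
theorem relaxation_step {g f : ℝ → ℝ} (hg : Continuous g) (hf : Continuous f)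
    {T r₀ B ρ δ l ε τ s : ℝ} (hr₀ : 0 ≤ r₀) (hl : 0 < l) (hε : 0 < ε) (hτ : 0 ≤ τ)
    (hlτ : 1 ≤ l * ε * τ) (hB : 0 < B) (hρ : 0 < ρ) (hs : 0 ≤ s)
    (hE : ∀ s t, 0 ≤ s → s ≤ t → t ≤ T → g t ≤ g s + (∫ r in s..t, f r) + δ)
    (hdrift : ∀ r ∈ Icc 0 T, (∀ q ∈ Icc (r - r₀) r, g q ≤ B) → f r ≤ -l * (g r - ρ * B))
    (hhist : ∀ q ∈ Icc (s - r₀) T, g q ≤ B) :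
    ∀ t ∈ Icc (s + τ) T, g t ≤ (ρ + ε) * B + δ := by
  intro t ht
  have hst : s ≤ t := by linarith [ht.1]
  have hd : ∀ r ∈ Icc s t, f r ≤ -l * (g r - ρ * B) := fun r hr =>
    hdrift r ⟨hs.trans hr.1, hr.2.trans ht.2⟩ fun q hq =>
      hhist q ⟨by linarith [hq.1, hr.1], by linarith [hq.2, hr.2, ht.2]⟩
  have hsB := hhist s ⟨by linarith, hst.trans ht.2⟩
  have hεB : 0 < ε * B := by positivity
  have hfinish : ∀ r ∈ Icc s t, (∀ q ∈ Icc r t, (ρ + ε) * B ≤ g q) →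
      g t ≤ g r - (t - r) * (l * (ε * B)) + δ := by
    intro r hr habove
    have h1 := hE r t (hs.trans hr.1) hr.2 ht.2
    have h2 : ∫ q in r..t, f q ≤ (t - r) * -(l * (ε * B)) :=
      intervalIntegral_le_const_mul hf hr.2 fun q hq => by
        have h3 := hd q ⟨hr.1.trans hq.1, hq.2⟩
        have h4 := habove q hq
        nlinarith
    linarith
  by_cases hex : ∃ r ∈ Icc s t, g r ≤ (ρ + ε) * B
  · obtain ⟨r, hr, hrB⟩ := hex
    rcases le_total (g t) ((ρ + ε) * B) with h | h
    · have := hE t t (hs.trans hst) le_rfl ht.2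
      simp only [intervalIntegral.integral_same] at this
      linarith
    · obtain ⟨q, hq, hqB, habove⟩ := exists_last_exit hg hr.2 hrB h
      have := hfinish q ⟨hr.1.trans hq.1, hq.2⟩ habove
      have h5 : 0 ≤ (t - q) * (l * (ε * B)) :=
        mul_nonneg (by linarith [hq.2]) (by positivity)
      linarith
  · push Not at hex
    have := hfinish s ⟨le_rfl, hst⟩ fun q hq => (hex q hq).le
    have h5 : B ≤ (t - s) * (l * (ε * B)) := by
      have h6 : τ * (l * (ε * B)) ≤ (t - s) * (l * (ε * B)) :=
        mul_le_mul_of_nonneg_right (by linarith [ht.1]) (by positivity)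
      nlinarith
    have : 0 < (ρ + ε) * B := by positivity
    linarith

/-- Iterating the relaxation step gives geometric decay of the history. -/
theorem relaxation_iterate {g f : ℝ → ℝ} (hg : Continuous g) (hf : Continuous f)
    {T r₀ L₀ L ρ δ l ε τ : ℝ} (hr₀ : 0 ≤ r₀) (hl : 0 < l) (hε : 0 < ε) (hτ : 0 ≤ τ)
    (hlτ : 1 ≤ l * ε * τ) (hL : 0 < L) (hρ : 0 < ρ) (hρε : ρ + 2 * ε ≤ 1) (k : ℕ)
    (hδ : δ ≤ ε * ((ρ + 2 * ε) ^ k * L)) (hL₀ : L₀ ≤ (ρ + 2 * ε) ^ k * L)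
    (hE : ∀ s t, 0 ≤ s → s ≤ t → t ≤ T → g t ≤ g s + (∫ r in s..t, f r) + δ)
    (hdrift : ∀ B ≥ L₀, ∀ r ∈ Icc 0 T, (∀ q ∈ Icc (r - r₀) r, g q ≤ B) →
      f r ≤ -l * (g r - ρ * B))
    (hhist : ∀ q ∈ Icc (-r₀) T, g q ≤ L) :
    ∀ q ∈ Icc (k * (τ + r₀) - r₀) T, g q ≤ (ρ + 2 * ε) ^ k * L := by
  suffices H : ∀ j ≤ k, ∀ q ∈ Icc (j * (τ + r₀) - r₀) T, g q ≤ (ρ + 2 * ε) ^ j * L from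
    H k le_rfl
  intro j
  induction j with
  | zero => intro _ q hq; simpa using hhist q (by simpa using hq)
  | succ j ih =>
    intro hj q hq
    have hpow : (ρ + 2 * ε) ^ k * L ≤ (ρ + 2 * ε) ^ j * L :=
      mul_le_mul_of_nonneg_right
        (pow_le_pow_of_le_one (by positivity) hρε (by omega)) hL.le
    have hstep := relaxation_step hg hf hr₀ hl hε hτ hlτ (B := (ρ + 2 * ε) ^ j * L)
      (by positivity) hρ (s := j * (τ + r₀)) (by positivity) hE
      (hdrift _ (hL₀.trans hpow)) (ih (by omega)) q
      ⟨by have := hq.1; push_cast at this; linarith, hq.2⟩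
    have h7 := mul_le_mul_of_nonneg_left hpow hε.le
    rw [pow_succ]
    linarith

end ScalarPaths

section GridEnergy

variable {E : Type*} [NormedAddCommGroup E]

/-- The quadratic variation of `M` along the grid of mesh `h`, restricted to the cells whose left
end is mapped into `D` by `y`. -/
def gridQV (y M : ℝ → E) (D : Set E) (h : ℝ) (j : ℕ) : ℝ :=
  ∑ k ∈ Finset.range j,
    D.indicator (fun _ => (1 : ℝ)) (y (k * h)) * ‖M ((k + 1) * h) - M (k * h)‖ ^ 2

theorem gridQV_nonneg (y M : ℝ → E) (D : Set E) (h : ℝ) (j : ℕ) : 0 ≤ gridQV y M D h j :=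
  Finset.sum_nonneg fun _ _ =>
    mul_nonneg (indicator_nonneg (fun _ _ => zero_le_one) _) (sq_nonneg _)

theorem gridQV_mono (y M : ℝ → E) (D : Set E) (h : ℝ) : Monotone (gridQV y M D h) :=
  monotone_nat_of_le_succ fun j => by
    unfold gridQV
    rw [Finset.sum_range_succ]
    linarith [mul_nonneg (indicator_nonneg (fun _ _ => zero_le_one) (y (j * h)) :
      0 ≤ D.indicator (fun _ => (1 : ℝ)) (y (j * h)))
      (sq_nonneg ‖M ((j + 1) * h) - M (j * h)‖)]

variable [InnerProductSpace ℝ E]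

/-- The Riemann sum of `∫ ⟪1_D(y) y, dM⟫` over the first `j` cells of the grid of mesh `h`. -/
def gridInt (y M : ℝ → E) (D : Set E) (h : ℝ) (j : ℕ) : ℝ :=
  ∑ k ∈ Finset.range j, ⟪D.indicator id (y (k * h)), M ((k + 1) * h) - M (k * h)⟫

variable [CompleteSpace E]

theorem inner_intervalIntegral {b : ℝ → E} (hb : Continuous b) (x : E) (u v : ℝ) :
    ⟪x, ∫ r in u..v, b r⟫ = ∫ r in u..v, ⟪x, b r⟫ :=
  ((innerSL ℝ x).intervalIntegral_comp_comm (hb.intervalIntegrable u v)).symm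

/-- Energy balance over one cell. -/
theorem energy_cell {y b : ℝ → E} (hy : Continuous y) (hb : Continuous b) {u v w β : ℝ}
    (huv : u ≤ v) (hw : 0 ≤ w) (hbβ : ∀ r ∈ Icc u v, ‖b r‖ ≤ β)
    (hyw : ∀ r ∈ Icc u v, ‖y u - y r‖ ≤ w) {N : E} (hN : N = y v - y u - ∫ r in u..v, b r) :
    ‖y v‖ ^ 2 ≤ ‖y u‖ ^ 2 + (∫ r in u..v, 2 * ⟪y r, b r⟫) + 2 * ⟪y u, N⟫ + 2 * ‖N‖ ^ 2
      + (v - u) * (2 * w * β + 2 * β ^ 2 * (v - u)) := by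
  set J := ∫ r in u..v, b r with hJ
  have hvu : y v = y u + (N + J) := by rw [hN]; abel
  have hJn : ‖J‖ ≤ β * (v - u) := by
    have := intervalIntegral.norm_integral_le_of_norm_le_const (a := u) (b := v) (f := b) (C := β)
      fun x hx => hbβ x (by rw [uIoc_of_le huv] at hx; exact ⟨hx.1.le, hx.2⟩)
    rwa [abs_of_nonneg (by linarith)] at this
  have hJsq : ‖J‖ ^ 2 ≤ β ^ 2 * (v - u) ^ 2 := by
    rw [← mul_pow]; exact pow_le_pow_left₀ (norm_nonneg _) hJn 2
  have hsum : ‖N + J‖ ^ 2 ≤ 2 * ‖N‖ ^ 2 + 2 * ‖J‖ ^ 2 := by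
    have := parallelogram_law_with_norm ℝ N J
    nlinarith [sq_nonneg ‖N - J‖]
  have hinner : 2 * ⟪y u, J⟫ ≤ (∫ r in u..v, 2 * ⟪y r, b r⟫) + (v - u) * (2 * w * β) := by
    have h1 : 2 * ⟪y u, J⟫ = ∫ r in u..v, 2 * ⟪y u, b r⟫ := by
      rw [intervalIntegral.integral_const_mul, hJ, inner_intervalIntegral hb]
    have h2 : (∫ r in u..v, 2 * ⟪y u, b r⟫) - (∫ r in u..v, 2 * ⟪y r, b r⟫)
        = ∫ r in u..v, 2 * ⟪y u - y r, b r⟫ := by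
      rw [← intervalIntegral.integral_sub]
      · congr 1; ext r; rw [inner_sub_left]; ring
      · exact Continuous.intervalIntegrable (by fun_prop) _ _
      · exact Continuous.intervalIntegrable (by fun_prop) _ _
    have h3 : ∫ r in u..v, 2 * ⟪y u - y r, b r⟫ ≤ (v - u) * (2 * w * β) :=
      intervalIntegral_le_const_mul (by fun_prop) huv fun r hr => by
        have h4 := real_inner_le_norm (y u - y r) (b r)
        have h5 := mul_le_mul (hyw r hr) (hbβ r hr) (norm_nonneg _) hw
        linarith
    linarith
  rw [hvu, norm_add_sq_real, inner_add_right]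
  nlinarith

/-- Energy balance between two grid points, as long as the path visits `D` in between. -/
theorem energy_grid {y b M : ℝ → E} (hy : Continuous y) (hb : Continuous b)
    (hM : ∀ u v, M v - M u = y v - y u - ∫ r in u..v, b r) {D : Set E} {h w β : ℝ}
    (hh : 0 ≤ h) (hw : 0 ≤ w) {i j : ℕ} (hij : i ≤ j)
    (hbβ : ∀ r ∈ Icc (i * h) (j * h), ‖b r‖ ≤ β)
    (hyw : ∀ q ∈ Icc (i * h) (j * h), ∀ r ∈ Icc (i * h) (j * h), |q - r| ≤ h → ‖y q - y r‖ ≤ w)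
    (hD : ∀ r ∈ Icc (i * h) (j * h), y r ∈ D) :
    ‖y (j * h)‖ ^ 2 ≤ ‖y (i * h)‖ ^ 2 + (∫ r in (i * h)..(j * h), 2 * ⟪y r, b r⟫)
      + 2 * (gridInt y M D h j - gridInt y M D h i) + 2 * (gridQV y M D h j - gridQV y M D h i)
      + (j * h - i * h) * (2 * w * β + 2 * β ^ 2 * h) := by
  induction j, hij using Nat.le_induction with
  | base => simp
  | succ j hij ih =>
    have hj1 : (j : ℝ) * h ≤ ((j + 1 : ℕ) : ℝ) * h :=
      mul_le_mul_of_nonneg_right (by push_cast; linarith) hh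
    have hij' : (i : ℝ) * h ≤ j * h := mul_le_mul_of_nonneg_right (by exact_mod_cast hij) hh
    have hsub : Icc (i * h) (j * h) ⊆ Icc ((i : ℝ) * h) (((j + 1 : ℕ) : ℝ) * h) :=
      Icc_subset_Icc_right hj1
    have hsub' : Icc (j * h) (((j + 1 : ℕ) : ℝ) * h) ⊆ Icc ((i : ℝ) * h) (((j + 1 : ℕ) : ℝ) * h) :=
      Icc_subset_Icc_left hij'
    have h1 := ih (fun r hr => hbβ r (hsub hr))
      (fun q hq r hr => hyw q (hsub hq) r (hsub hr)) (fun r hr => hD r (hsub hr))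
    have hlen : ((j + 1 : ℕ) : ℝ) * h - j * h = h := by push_cast; ring
    have hmem : (j : ℝ) * h ∈ Icc ((j : ℝ) * h) (((j + 1 : ℕ) : ℝ) * h) := ⟨le_rfl, hj1⟩
    have h2 := energy_cell hy hb hj1 hw (fun r hr => hbβ r (hsub' hr))
      (fun r hr => hyw _ (hsub' hmem) r (hsub' hr) (by
        rw [abs_le]; constructor <;> linarith [hr.1, hr.2])) (hM _ _)
    have hDj : y (j * h) ∈ D := hD _ (hsub' hmem)
    have h3 : gridInt y M D h (j + 1) = gridInt y M D h j
        + ⟪y (j * h), M (((j + 1 : ℕ) : ℝ) * h) - M (j * h)⟫ := by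
      unfold gridInt
      rw [Finset.sum_range_succ, indicator_of_mem hDj]
      push_cast; rfl
    have h4 : gridQV y M D h (j + 1) = gridQV y M D h j
        + ‖M (((j + 1 : ℕ) : ℝ) * h) - M (j * h)‖ ^ 2 := by
      unfold gridQV
      rw [Finset.sum_range_succ, indicator_of_mem hDj, one_mul]
      push_cast; rfl
    have hcont : Continuous fun r => 2 * ⟪y r, b r⟫ := by fun_prop
    have h5 := intervalIntegral.integral_add_adjacent_intervals
      (hcont.intervalIntegrable (μ := volume) (i * h) (j * h))
      (hcont.intervalIntegrable (j * h) (((j + 1 : ℕ) : ℝ) * h))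
    rw [h3, h4, ← h5]
    rw [hlen] at h2
    have h6 : ((j + 1 : ℕ) : ℝ) * h - i * h = (j * h - i * h) + h := by push_cast; ring
    rw [h6]
    linarith

/-- If the discrete stochastic integrals and the discrete quadratic variation are small along
infinitely many grids, the energy inequality holds in continuous time with a small error. -/
theorem energy_inequality_of_frequently {y b M : ℝ → E} (hy : Continuous y) (hb : Continuous b)
    (hM : ∀ u v, M v - M u = y v - y u - ∫ r in u..v, b r) {D : Set E} {T c : ℝ}
    (hT : 0 < T) (hc : 0 < c)
    (hfreq : ∃ᶠ n : ℕ in atTop, (∀ j ≤ n + 1, |gridInt y M D (T / (n + 1)) j| < c) ∧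
      gridQV y M D (T / (n + 1)) (n + 1) < c)
    {s t : ℝ} (hs : 0 ≤ s) (hst : s ≤ t) (ht : t ≤ T) (hD : ∀ r ∈ Icc s t, y r ∈ D) :
    ‖y t‖ ^ 2 ≤ ‖y s‖ ^ 2 + (∫ r in s..t, 2 * ⟪y r, b r⟫) + 7 * c := by
  rcases hst.eq_or_lt with rfl | hlt
  · simp only [intervalIntegral.integral_same]; linarith
  have hcont : Continuous fun r => 2 * ⟪y r, b r⟫ := by fun_prop
  obtain ⟨β', hβ'⟩ := (isCompact_Icc (a := (0 : ℝ)) (b := T)).exists_bound_of_continuousOn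
    hb.continuousOn
  set β := max β' 0
  have hβ : ∀ r ∈ Icc (0 : ℝ) T, ‖b r‖ ≤ β := fun r hr => (hβ' r hr).trans (le_max_left _ _)
  have hβ0 : 0 ≤ β := le_max_right _ _
  set w := c / (4 * T * (β + 1)) with hwdef
  have hw : 0 < w := by positivity
  have huc := (isCompact_Icc (a := (0 : ℝ)) (b := T)).uniformContinuousOn_of_continuous
    hy.continuousOn
  obtain ⟨η, hη, hyη⟩ := Metric.uniformContinuousOn_iff.1 huc w hw
  set hn : ℕ → ℝ := fun n => T / (n + 1) with hhn
  have hn0 : ∀ n, 0 < hn n := fun n => by positivity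
  have hnlim : Tendsto hn atTop (𝓝 0) := by
    have := (tendsto_one_div_add_atTop_nhds_zero_nat (𝕜 := ℝ)).const_mul T
    simpa [hhn, div_eq_mul_inv] using this
  set i : ℕ → ℕ := fun n => ⌈s / hn n⌉₊ with hi
  set j : ℕ → ℕ := fun n => ⌊t / hn n⌋₊ with hj
  have hi1 : ∀ n, s ≤ i n * hn n := fun n => by
    rw [← div_le_iff₀ (hn0 n)]; exact Nat.le_ceil _
  have hi2 : ∀ n, i n * hn n ≤ s + hn n := fun n => by
    have := (Nat.ceil_lt_add_one (div_nonneg hs (hn0 n).le)).le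
    calc i n * hn n ≤ (s / hn n + 1) * hn n := mul_le_mul_of_nonneg_right this (hn0 n).le
      _ = s + hn n := by have := (hn0 n).ne'; field_simp
  have hj1 : ∀ n, j n * hn n ≤ t := fun n => by
    rw [← le_div_iff₀ (hn0 n)]; exact Nat.floor_le (div_nonneg (hs.trans hst) (hn0 n).le)
  have hj2 : ∀ n, t - hn n ≤ j n * hn n := fun n => by
    have := (Nat.lt_floor_add_one (t / hn n)).le
    have h2 : t ≤ (j n + 1) * hn n := by rwa [← div_le_iff₀ (hn0 n)]
    linarith
  have hilim : Tendsto (fun n => i n * hn n) atTop (𝓝 s) :=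
    tendsto_of_tendsto_of_tendsto_of_le_of_le tendsto_const_nhds
      (by simpa using hnlim.const_add s) hi1 hi2
  have hjlim : Tendsto (fun n => j n * hn n) atTop (𝓝 t) :=
    tendsto_of_tendsto_of_tendsto_of_le_of_le
      (by simpa using hnlim.const_sub t) tendsto_const_nhds hj2 hj1
  have hjn : ∀ n, j n ≤ n + 1 := fun n => by
    apply Nat.floor_le_of_le
    rw [div_le_iff₀ (hn0 n)]
    have : ((n + 1 : ℕ) : ℝ) * hn n = T := by
      simp only [hhn]; push_cast; field_simp
    linarith
  have hInt : Tendsto (fun n => ∫ r in (i n * hn n)..(j n * hn n), 2 * ⟪y r, b r⟫) atTop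
      (𝓝 (∫ r in s..t, 2 * ⟪y r, b r⟫)) := by
    have hprim : Continuous fun x => ∫ r in (0 : ℝ)..x, 2 * ⟪y r, b r⟫ :=
      intervalIntegral.continuous_primitive (fun a b => hcont.intervalIntegrable a b) 0
    have hdiff : ∀ u v, ∫ r in u..v, 2 * ⟪y r, b r⟫
        = (∫ r in (0 : ℝ)..v, 2 * ⟪y r, b r⟫) - ∫ r in (0 : ℝ)..u, 2 * ⟪y r, b r⟫ := fun u v =>
      (intervalIntegral.integral_interval_sub_left (hcont.intervalIntegrable _ _)
        (hcont.intervalIntegrable _ _)).symm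
    rw [hdiff s t]
    refine Tendsto.congr (fun n => (hdiff _ _).symm) ?_
    exact ((hprim.tendsto t).comp hjlim).sub ((hprim.tendsto s).comp hilim)
  have hlim : Tendsto (fun n => ‖y (j n * hn n)‖ ^ 2 - ‖y (i n * hn n)‖ ^ 2
      - ∫ r in (i n * hn n)..(j n * hn n), 2 * ⟪y r, b r⟫) atTop
      (𝓝 (‖y t‖ ^ 2 - ‖y s‖ ^ 2 - ∫ r in s..t, 2 * ⟪y r, b r⟫)) :=
    (((((hy.tendsto t).comp hjlim).norm.pow 2).sub
      (((hy.tendsto s).comp hilim).norm.pow 2)).sub hInt)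
  have hev : ∀ᶠ n in atTop, i n ≤ j n ∧ hn n < η ∧ T * (2 * β ^ 2 * hn n) ≤ c / 2 := by
    have e1 : ∀ᶠ n in atTop, (i n : ℝ) * hn n < j n * hn n := hilim.eventually_lt hjlim hlt
    have e2 : ∀ᶠ n in atTop, hn n < η := hnlim.eventually_lt_const hη
    have e3 : Tendsto (fun n => T * (2 * β ^ 2 * hn n)) atTop (𝓝 0) := by
      simpa using (hnlim.const_mul (2 * β ^ 2)).const_mul T
    have e4 := e3.eventually_lt_const (half_pos hc)
    filter_upwards [e1, e2, e4] with n h1 h2 h3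
    exact ⟨by exact_mod_cast (lt_of_mul_lt_mul_right h1 (hn0 n).le).le, h2, h3.le⟩
  have hfin := le_of_tendsto_of_frequently hlim (b := 7 * c)
    ((hfreq.and_eventually hev).mono fun n hn' => ?_)
  · linarith
  obtain ⟨⟨hI, hQ⟩, hijn, hnη, hsmall⟩ := hn'
  have hin : Icc ((i n : ℝ) * hn n) (j n * hn n) ⊆ Icc 0 T := fun r hr =>
    ⟨hs.trans ((hi1 n).trans hr.1), (hr.2.trans (hj1 n)).trans ht⟩
  have hmain := energy_grid hy hb hM (D := D) (hn0 n).le hw.le hijn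
    (fun r hr => hβ r (hin hr))
    (fun q hq r hr hqr => by
      rw [← dist_eq_norm]
      exact (hyη q (hin hq) r (hin hr) (by rw [Real.dist_eq]; linarith)).le)
    (fun r hr => hD r ⟨(hi1 n).trans hr.1, hr.2.trans (hj1 n)⟩)
  have hIj := abs_lt.1 (hI _ (hjn n))
  have hIi := abs_lt.1 (hI _ (hijn.trans (hjn n)))
  have hQj : gridQV y M D (hn n) (j n) < c := (gridQV_mono y M D (hn n) (hjn n)).trans_lt hQ
  have hQi := gridQV_nonneg y M D (hn n) (i n)
  have herr : (j n * hn n - i n * hn n) * (2 * w * β + 2 * β ^ 2 * hn n) ≤ c := by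
    have h1 : (j n * hn n - i n * hn n) * (2 * w * β + 2 * β ^ 2 * hn n)
        ≤ T * (2 * w * β + 2 * β ^ 2 * hn n) := by
      have := (hn0 n).le
      exact mul_le_mul_of_nonneg_right (by linarith [hj1 n, hi1 n]) (by positivity)
    have h2 : T * (2 * w * β) ≤ c / 2 := by
      rw [hwdef]
      rw [show T * (2 * (c / (4 * T * (β + 1))) * β) = c / 2 * (β / (β + 1)) by field_simp; ring]
      have : β / (β + 1) ≤ 1 := (div_le_one (by positivity)).2 (by linarith)
      nlinarith
    linarith
  linarith

end GridEnergy

section SquareIntegrable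

variable {Ω ι : Type*} {mΩ : MeasurableSpace Ω} {P : Measure Ω} [IsProbabilityMeasure P]
  [Preorder ι] {ℱ : Filtration ι mΩ}

/-- Increments of a square integrable martingale are orthogonal to the past. -/
theorem integral_mul_martingale_increment {N : ι → Ω → ℝ} (hN : Martingale N ℱ P) {s t : ι}
    (hst : s ≤ t) (hs : MemLp (N s) 2 P) (ht : MemLp (N t) 2 P) {ψ : Ω → ℝ}
    (hψm : StronglyMeasurable[ℱ s] ψ) (hψ : MemLp ψ 2 P) :
    ∫ ω, ψ ω * (N t ω - N s ω) ∂P = 0 := by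
  have hΔ : MemLp (N t - N s) 2 P := ht.sub hs
  have hInt : Integrable (ψ * (N t - N s)) P := hψ.integrable_mul hΔ
  have h1 := condExp_mul_of_stronglyMeasurable_left (m := ℱ s) hψm hInt
    (hΔ.integrable one_le_two)
  have h2 : P[N t - N s | ℱ s] =ᵐ[P] 0 := by
    filter_upwards [condExp_sub (hN.integrable t) (hN.integrable s) (ℱ s), hN.condExp_ae_eq hst,
      hN.condExp_ae_eq (le_refl s)] with ω h3 h4 h5
    rw [h3, Pi.sub_apply, h4, h5, sub_self, Pi.zero_apply]
  calc ∫ ω, ψ ω * (N t ω - N s ω) ∂P = ∫ ω, (P[ψ * (N t - N s) | ℱ s]) ω ∂P :=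
        (integral_condExp (ℱ.le s)).symm
    _ = ∫ _, (0 : ℝ) ∂P := integral_congr_ae <| by
        filter_upwards [h1, h2] with ω h3 h4
        rw [h3, Pi.mul_apply, h4, Pi.zero_apply, mul_zero]
    _ = 0 := by simp

/-- A martingale with bounded compensator is square integrable. -/
theorem memLp_two_of_bounded_compensator {N A : ι → Ω → ℝ} (hN : Martingale N ℱ P)
    (hQ : Martingale (fun t ω => N t ω * N t ω - A t ω) ℱ P) {t : ι} {K : ℝ}
    (hA : ∀ ω, |A t ω| ≤ K) : Integrable (A t) P ∧ MemLp (N t) 2 P := by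
  have hNm := (hN.integrable t).aestronglyMeasurable
  have hAm : AEStronglyMeasurable (A t) P := by
    have := (hNm.mul hNm).sub (hQ.integrable t).aestronglyMeasurable
    refine this.congr (.of_forall fun ω => ?_)
    simp
  have hAi : Integrable (A t) P := Integrable.of_bound hAm K (.of_forall fun ω => hA ω)
  refine ⟨hAi, (memLp_two_iff_integrable_sq hNm).2 ?_⟩
  refine ((hQ.integrable t).add hAi).congr (.of_forall fun ω => ?_)
  simp [sq]

/-- Conditional variance bound for the increments of a martingale whose compensator has increments
at most `K`. -/
theorem setIntegral_sq_martingale_increment_le {N A : ι → Ω → ℝ} (hN : Martingale N ℱ P)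
    (hQ : Martingale (fun t ω => N t ω * N t ω - A t ω) ℱ P) {s t : ι} (hst : s ≤ t)
    {K Ks Kt : ℝ} (hAs : ∀ ω, |A s ω| ≤ Ks) (hAt : ∀ ω, |A t ω| ≤ Kt)
    (hK : ∀ ω, A t ω - A s ω ≤ K) {D : Set Ω} (hD : MeasurableSet[ℱ s] D) :
    ∫ ω in D, (N t ω - N s ω) ^ 2 ∂P ≤ K * P.real D := by
  obtain ⟨hAsi, hNs⟩ := memLp_two_of_bounded_compensator hN hQ hAs
  obtain ⟨hAti, hNt⟩ := memLp_two_of_bounded_compensator hN hQ hAt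
  have hD' : MeasurableSet D := ℱ.le s D hD
  have hcross : ∫ ω in D, N s ω * (N t ω - N s ω) ∂P = 0 := by
    rw [← integral_mul_martingale_increment hN hst hNs hNt
      ((hN.stronglyMeasurable s).indicator hD) (hNs.indicator hD'), ← integral_indicator hD']
    congr 1; ext ω
    by_cases h : ω ∈ D <;> simp [h]
  have hcrossi : Integrable (fun ω => N s ω * (N t ω - N s ω)) P :=
    hNs.integrable_mul (hNt.sub hNs)
  have hmart := hQ.setIntegral_eq hst hD
  have hdecomp : ∀ ω, (N t ω - N s ω) ^ 2 = (N t ω * N t ω - A t ω) - (N s ω * N s ω - A s ω)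
      + (A t ω - A s ω) - 2 * (N s ω * (N t ω - N s ω)) := fun ω => by ring
  simp_rw [hdecomp]
  have hAle : ∫ ω in D, (A t ω - A s ω) ∂P ≤ K * P.real D := by
    have := setIntegral_mono (s := D) (hAti.sub hAsi).integrableOn
      (integrableOn_const (measure_ne_top P D)) hK
    simpa [mul_comm] using this
  rw [integral_sub, integral_add, integral_sub, integral_const_mul, hcross, hmart]
  · linarith
  · exact (hQ.integrable t).integrableOn
  · exact (hQ.integrable s).integrableOn
  · exact ((hQ.integrable t).sub (hQ.integrable s)).integrableOn
  · exact (hAti.sub hAsi).integrableOn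
  · exact (((hQ.integrable t).sub (hQ.integrable s)).add (hAti.sub hAsi)).integrableOn
  · exact (hcrossi.const_mul 2).integrableOn

/-- Kolmogorov's maximal inequality for sums of orthogonal martingale increments. -/
theorem measureReal_exists_abs_sum_ge_le {𝒢 : Filtration ℕ mΩ} {ζ : ℕ → Ω → ℝ}
    (hζm : ∀ k, StronglyMeasurable[𝒢 (k + 1)] (ζ k)) (hζ : ∀ k, MemLp (ζ k) 2 P)
    (horth : ∀ k (ψ : Ω → ℝ), StronglyMeasurable[𝒢 k] ψ → MemLp ψ 2 P →
      ∫ ω, ψ ω * ζ k ω ∂P = 0)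
    {v c : ℝ} (n : ℕ) (hv : ∀ k < n, ∫ ω, ζ k ω ^ 2 ∂P ≤ v) (hc : 0 < c) :
    P.real {ω | ∃ j ≤ n, c ≤ |∑ k ∈ Finset.range j, ζ k ω|} ≤ n * v / c ^ 2 := by
  set I : ℕ → Ω → ℝ := fun j ω => ∑ k ∈ Finset.range j, ζ k ω with hI
  have hIsucc : ∀ j ω, I (j + 1) ω = I j ω + ζ j ω := fun j ω => Finset.sum_range_succ _ _
  have hIm : ∀ j, StronglyMeasurable[𝒢 j] (I j) := fun j =>
    Finset.stronglyMeasurable_fun_sum _ fun k hk =>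
      (hζm k).mono (𝒢.mono (Finset.mem_range.1 hk))
  have hI2 : ∀ j, MemLp (I j) 2 P := fun j => memLp_finsetSum _ fun k _ => hζ k
  have hIsq : ∀ j, Integrable (fun ω => I j ω ^ 2) P := fun j => (hI2 j).integrable_sq
  have hexp : ∀ j ω, I (j + 1) ω ^ 2 = I j ω ^ 2 + 2 * (I j ω * ζ j ω) + ζ j ω ^ 2 :=
    fun j ω => by rw [hIsucc]; ring
  have hcrossi : ∀ j, Integrable (fun ω => 2 * (I j ω * ζ j ω)) P := fun j =>
    ((hI2 j).integrable_mul (hζ j)).const_mul 2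
  have hsub : Submartingale (fun j ω => I j ω ^ 2) 𝒢 P := by
    refine submartingale_of_setIntegral_le_succ (fun j => (hIm j).pow 2) hIsq fun j D hD => ?_
    have hD' : MeasurableSet D := 𝒢.le j D hD
    have hcross : ∫ ω in D, I j ω * ζ j ω ∂P = 0 := by
      rw [← horth j _ ((hIm j).indicator hD) ((hI2 j).indicator hD'), ← integral_indicator hD']
      congr 1; ext ω
      by_cases h : ω ∈ D <;> simp [h]
    simp_rw [hexp]
    rw [integral_add, integral_add, integral_const_mul, hcross]
    · have : 0 ≤ ∫ ω in D, ζ j ω ^ 2 ∂P := integral_nonneg fun ω => sq_nonneg _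
      linarith
    · exact (hIsq j).integrableOn
    · exact (hcrossi j).integrableOn
    · exact ((hIsq j).add (hcrossi j)).integrableOn
    · exact (hζ j).integrable_sq.integrableOn
  have hsecond : ∀ j ≤ n, ∫ ω, I j ω ^ 2 ∂P ≤ j * v := by
    intro j
    induction j with
    | zero => intro _; simp [hI]
    | succ j ih =>
      intro hj
      simp_rw [hexp]
      rw [integral_add, integral_add, integral_const_mul, horth j _ (hIm j) (hI2 j)]
      · have := ih (by omega)
        have := hv j (by omega)
        push_cast
        linarith
      · exact hIsq j
      · exact hcrossi j
      · exact (hIsq j).add (hcrossi j)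
      · exact (hζ j).integrable_sq
  set ε : ℝ≥0 := (c ^ 2).toNNReal with hε
  have hεc : (ε : ℝ) = c ^ 2 := Real.coe_toNNReal _ (by positivity)
  have hmax := maximal_ineq hsub (fun j ω => sq_nonneg (I j ω)) (ε := ε) n
  set B : Set Ω := {ω | (ε : ℝ) ≤ (Finset.range (n + 1)).sup' Finset.nonempty_range_add_one
    fun k => I k ω ^ 2} with hB
  have hsubset : {ω | ∃ j ≤ n, c ≤ |I j ω|} ⊆ B := by
    rintro ω ⟨j, hj, hcj⟩
    rw [hB, mem_ofPred_eq, Finset.le_sup'_iff]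
    refine ⟨j, Finset.mem_range.2 (by omega), ?_⟩
    rw [hεc, ← sq_abs (I j ω)]
    exact pow_le_pow_left₀ hc.le hcj 2
  have hBn : c ^ 2 * P.real B ≤ n * v := by
    have h1 : ∫ ω in B, I n ω ^ 2 ∂P ≤ ∫ ω, I n ω ^ 2 ∂P :=
      setIntegral_le_integral (hIsq n) (.of_forall fun ω => sq_nonneg _)
    have h2 := ENNReal.toReal_mono ENNReal.ofReal_ne_top hmax
    rw [ENNReal.toReal_mul, ENNReal.toReal_ofReal (integral_nonneg fun ω => sq_nonneg _)] at h2
    have h3 : ((ε : ℝ≥0∞)).toReal = c ^ 2 := by rw [ENNReal.coe_toReal, hεc]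
    rw [h3] at h2
    exact (h2.trans h1).trans (hsecond n le_rfl)
  rw [le_div_iff₀ (by positivity), mul_comm]
  exact (mul_le_mul_of_nonneg_left (measureReal_mono hsubset) (by positivity)).trans hBn

/-- If sets `B n` have probability at most `q`, so has the set of points lying in all but finitely
many of them. -/
theorem measureReal_eventually_mem_le {B : ℕ → Set Ω} {q : ℝ} (h : ∀ n, P.real (B n) ≤ q) :
    P.real {ω | ∀ᶠ n in atTop, ω ∈ B n} ≤ q := by
  have hq : 0 ≤ q := measureReal_nonneg.trans (h 0)
  have heq : {ω | ∀ᶠ n in atTop, ω ∈ B n} = ⋃ n, ⋂ m ≥ n, B m := by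
    ext ω; simp [eventually_atTop]
  have hmono : Monotone fun n => ⋂ m ≥ n, B m := fun a b hab ω hω => by
    simp only [mem_iInter] at hω ⊢
    exact fun m hm => hω m (le_trans hab hm)
  rw [heq, measureReal_def, hmono.measure_iUnion]
  refine ENNReal.toReal_le_of_le_ofReal hq (iSup_le fun n => ?_)
  refine (measure_mono (biInter_subset_of_mem (show n ∈ {m | m ≥ n} from le_refl n))).trans ?_
  rw [← ofReal_measureReal]
  exact ENNReal.ofReal_le_ofReal (h n)

end SquareIntegrable

section Paths

/-- The window process of the path `S.Y ξ ω`, as a continuous function of all real times. -/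
def PathSDE.segPath (S : PathSDE d r₀ Ω P) (ξ : Seg d r₀) (ω : Ω) : C(ℝ, Seg d r₀) :=
  ContinuousMap.curry ⟨fun q : ℝ × Icc (-r₀) (0 : ℝ) => S.Y ξ ω (q.1 + q.2.1),
    (S.hYcont ξ ω).comp (by fun_prop)⟩

theorem PathSDE.X_eq_segPath (S : PathSDE d r₀ Ω P) (ξ : Seg d r₀) (ω : Ω) {t : ℝ} (ht : 0 ≤ t) :
    S.X ξ t ω = S.segPath ξ ω t := by
  ext1 θ
  exact S.hX ξ t ht ω θ

/-- The drift along the path. -/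
def PathSDE.driftPath (S : PathSDE d r₀ Ω P) (ξ : Seg d r₀) (ω : Ω) (r : ℝ) : EucSp d :=
  S.b (S.segPath ξ ω r)

theorem PathSDE.continuous_driftPath (S : PathSDE d r₀ Ω P) (ξ : Seg d r₀) (ω : Ω) :
    Continuous (S.driftPath ξ ω) :=
  S.hA1bcont.comp (S.segPath ξ ω).continuous

/-- The martingale part of the path. -/
def PathSDE.martPath (S : PathSDE d r₀ Ω P) (ξ : Seg d r₀) (ω : Ω) (t : ℝ) : EucSp d :=
  S.Y ξ ω t - ev0 S.hr₀ ξ - ∫ s in (0 : ℝ)..t, S.driftPath ξ ω s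

theorem PathSDE.martPath_sub (S : PathSDE d r₀ Ω P) (ξ : Seg d r₀) (ω : Ω) (u v : ℝ) :
    S.martPath ξ ω v - S.martPath ξ ω u
      = S.Y ξ ω v - S.Y ξ ω u - ∫ s in u..v, S.driftPath ξ ω s := by
  have hc := S.continuous_driftPath ξ ω
  have := intervalIntegral.integral_interval_sub_left (hc.intervalIntegrable (μ := volume) 0 v)
    (hc.intervalIntegrable 0 u)
  rw [← this, PathSDE.martPath, PathSDE.martPath]
  abel

theorem PathSDE.inner_martPath (S : PathSDE d r₀ Ω P) (ξ : Seg d r₀) (ω : Ω) (u : EucSp d)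
    {t : ℝ} (ht : 0 ≤ t) :
    ⟪u, S.martPath ξ ω t⟫ = ⟪u, S.Y ξ ω t⟫ - ⟪u, ev0 S.hr₀ ξ⟫
      - ∫ s in (0 : ℝ)..t, ⟪u, S.b (S.X ξ s ω)⟫ := by
  rw [PathSDE.martPath, inner_sub_right, inner_sub_right,
    inner_intervalIntegral (S.continuous_driftPath ξ ω)]
  congr 1
  refine intervalIntegral.integral_congr fun s hs => ?_
  rw [uIcc_of_le ht] at hs
  simp only [PathSDE.driftPath, S.X_eq_segPath ξ ω hs.1]

/-- The compensator of `⟪u, M⟫²`. -/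
def PathSDE.comp (S : PathSDE d r₀ Ω P) (ξ : Seg d r₀) (u : EucSp d) (t : ℝ) (ω : Ω) : ℝ :=
  ∫ s in (0 : ℝ)..(max t 0), ‖ContinuousLinearMap.adjoint (S.σ (S.segPath ξ ω s)) u‖ ^ 2

theorem PathSDE.martingale_inner (S : PathSDE d r₀ Ω P) (ξ : Seg d r₀) (u : EucSp d) :
    Martingale (fun t ω => ⟪u, S.martPath ξ ω (max t 0)⟫) S.ℱ P := by
  have := S.hSDE₁ ξ u
  simpa only [← S.inner_martPath ξ _ u (le_max_right _ _)] using this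

theorem PathSDE.martingale_inner_sq (S : PathSDE d r₀ Ω P) (ξ : Seg d r₀) (u : EucSp d) :
    Martingale (fun t ω => ⟪u, S.martPath ξ ω (max t 0)⟫ * ⟪u, S.martPath ξ ω (max t 0)⟫
      - S.comp ξ u t ω) S.ℱ P := by
  have hcomp : ∀ t ω, S.comp ξ u t ω = ∫ s in (0 : ℝ)..(max t 0),
      ⟪(ContinuousLinearMap.adjoint (S.σ (S.X ξ s ω))) u,
        (ContinuousLinearMap.adjoint (S.σ (S.X ξ s ω))) u⟫ := fun t ω => by
    refine intervalIntegral.integral_congr fun s hs => ?_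
    rw [uIcc_of_le (le_max_right _ _)] at hs
    simp only [S.X_eq_segPath ξ ω hs.1, real_inner_self_eq_norm_sq]
  have := S.hSDE₂ ξ u u
  simpa only [← S.inner_martPath ξ _ u (le_max_right _ _), ← hcomp] using this

theorem PathSDE.exists_comp_bound (S : PathSDE d r₀ Ω P) : ∃ C : ℝ, 0 ≤ C ∧
    ∀ (ξ : Seg d r₀) (u : EucSp d), ‖u‖ = 1 →
      (∀ t ω, |S.comp ξ u t ω| ≤ C * max t 0) ∧
      ∀ s t, 0 ≤ s → s ≤ t → ∀ ω, S.comp ξ u t ω - S.comp ξ u s ω ≤ C * (t - s) := by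
  obtain ⟨C, hC⟩ := S.hA3
  obtain ⟨Lσ, hLσ⟩ := S.hA1σ
  refine ⟨C ^ 2, sq_nonneg C, fun ξ u hu => ?_⟩
  have hb : ∀ ω s, ‖ContinuousLinearMap.adjoint (S.σ (S.segPath ξ ω s)) u‖ ^ 2 ≤ C ^ 2 := by
    intro ω s
    refine pow_le_pow_left₀ (norm_nonneg _) ?_ 2
    refine (ContinuousLinearMap.le_opNorm _ _).trans ?_
    rw [hu, mul_one, LinearIsometryEquiv.norm_map]
    linarith [hC (S.segPath ξ ω s), norm_nonneg (S.σinv (S.segPath ξ ω s))]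
  have hcont : ∀ ω, Continuous fun s =>
      ‖ContinuousLinearMap.adjoint (S.σ (S.segPath ξ ω s)) u‖ ^ 2 := fun ω => by
    have h1 : Continuous fun s => S.σ (S.segPath ξ ω s) :=
      hLσ.continuous.comp (S.segPath ξ ω).continuous
    have h2 : Continuous fun s => ContinuousLinearMap.adjoint (S.σ (S.segPath ξ ω s)) :=
      ContinuousLinearMap.adjoint.continuous.comp h1
    exact ((h2.clm_apply continuous_const).norm).pow 2
  constructor
  · intro t ω
    have := intervalIntegral.norm_integral_le_of_norm_le_const (a := 0) (b := max t 0)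
      (f := fun s => ‖ContinuousLinearMap.adjoint (S.σ (S.segPath ξ ω s)) u‖ ^ 2) (C := C ^ 2)
      fun s _ => by rw [Real.norm_of_nonneg (sq_nonneg _)]; exact hb ω s
    rwa [Real.norm_eq_abs, sub_zero, abs_of_nonneg (le_max_right t 0)] at this
  · intro s t hs hst ω
    rw [PathSDE.comp, PathSDE.comp, max_eq_left hs, max_eq_left (hs.trans hst),
      intervalIntegral.integral_interval_sub_left ((hcont ω).intervalIntegrable _ _)
        ((hcont ω).intervalIntegrable _ _), mul_comm]
    exact intervalIntegral_le_const_mul (hcont ω) hst fun r _ => hb ω r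

theorem PathSDE.sum_inner_smul (x : EucSp d) :
    x = ∑ i, ⟪EuclideanSpace.basisFun (Fin d) ℝ i, x⟫ • EuclideanSpace.basisFun (Fin d) ℝ i :=
  ((EuclideanSpace.basisFun (Fin d) ℝ).sum_repr' x).symm

theorem PathSDE.stronglyMeasurable_Y (S : PathSDE d r₀ Ω P) (ξ : Seg d r₀) {t : ℝ} (ht : 0 ≤ t) :
    StronglyMeasurable[S.ℱ t] fun ω => S.Y ξ ω t := by
  have h0 : (0 : ℝ) ∈ Icc (-r₀) (0 : ℝ) := ⟨neg_nonpos.2 S.hr₀.le, le_rfl⟩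
  have hev : Continuous fun ζ : Seg d r₀ => ζ ⟨0, h0⟩ := continuous_eval_const _
  have := hev.comp_stronglyMeasurable (S.hXadapted ξ t ht)
  convert this using 1
  ext1 ω
  simp [S.hX ξ t ht ω]

theorem PathSDE.stronglyMeasurable_martPath (S : PathSDE d r₀ Ω P) (ξ : Seg d r₀) {t : ℝ}
    (ht : 0 ≤ t) : StronglyMeasurable[S.ℱ t] fun ω => S.martPath ξ ω t := by
  have h : (fun ω => S.martPath ξ ω t) = fun ω => ∑ i,
      ⟪EuclideanSpace.basisFun (Fin d) ℝ i, S.martPath ξ ω t⟫ •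
        EuclideanSpace.basisFun (Fin d) ℝ i := by
    ext1 ω; exact PathSDE.sum_inner_smul _
  rw [h]
  refine Finset.stronglyMeasurable_fun_sum _ fun i _ => ?_
  have := (S.martingale_inner ξ (EuclideanSpace.basisFun (Fin d) ℝ i)).stronglyMeasurable t
  simp only [max_eq_left ht] at this
  exact this.smul_const _

theorem PathSDE.memLp_inner_martPath (S : PathSDE d r₀ Ω P) (ξ : Seg d r₀) {u : EucSp d}
    (hu : ‖u‖ = 1) (t : ℝ) : MemLp (fun ω => ⟪u, S.martPath ξ ω (max t 0)⟫) 2 P := by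
  have := S.hP
  obtain ⟨C, _, hC⟩ := S.exists_comp_bound
  exact (memLp_two_of_bounded_compensator (S.martingale_inner ξ u) (S.martingale_inner_sq ξ u)
    ((hC ξ u hu).1 t)).2

theorem PathSDE.memLp_martPath (S : PathSDE d r₀ Ω P) (ξ : Seg d r₀) {t : ℝ} (ht : 0 ≤ t) :
    MemLp (fun ω => S.martPath ξ ω t) 2 P := by
  have h : (fun ω => S.martPath ξ ω t) = fun ω => ∑ i,
      ⟪EuclideanSpace.basisFun (Fin d) ℝ i, S.martPath ξ ω t⟫ •
        EuclideanSpace.basisFun (Fin d) ℝ i := by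
    ext1 ω; exact PathSDE.sum_inner_smul _
  rw [h]
  refine memLp_finsetSum _ fun i _ => ?_
  have := S.memLp_inner_martPath ξ ((EuclideanSpace.basisFun (Fin d) ℝ).norm_eq_one i) t
  simp only [max_eq_left ht] at this
  have hm := (continuous_id.smul continuous_const :
    Continuous fun x : ℝ => x • EuclideanSpace.basisFun (Fin d) ℝ i)
  refine MemLp.of_le this (hm.comp_aestronglyMeasurable this.aestronglyMeasurable)
    (.of_forall fun ω => ?_)
  rw [norm_smul, (EuclideanSpace.basisFun (Fin d) ℝ).norm_eq_one i, mul_one]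

/-- Increments of the martingale part are orthogonal to the past. -/
theorem PathSDE.integral_mul_inner_increment (S : PathSDE d r₀ Ω P) (ξ : Seg d r₀) {s t L : ℝ}
    (hs : 0 ≤ s) (hst : s ≤ t) {H : Ω → EucSp d} (hHm : StronglyMeasurable[S.ℱ s] H)
    (hH : ∀ ω, ‖H ω‖ ≤ L) {ψ : Ω → ℝ} (hψm : StronglyMeasurable[S.ℱ s] ψ) (hψ : MemLp ψ 2 P) :
    ∫ ω, ψ ω * ⟪H ω, S.martPath ξ ω t - S.martPath ξ ω s⟫ ∂P = 0 := by
  have := S.hP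
  set e := EuclideanSpace.basisFun (Fin d) ℝ with he
  have ht : 0 ≤ t := hs.trans hst
  have hexp : ∀ ω, ψ ω * ⟪H ω, S.martPath ξ ω t - S.martPath ξ ω s⟫
      = ∑ i, (ψ ω * ⟪H ω, e i⟫) * (⟪e i, S.martPath ξ ω t⟫ - ⟪e i, S.martPath ξ ω s⟫) := by
    intro ω
    rw [← e.sum_inner_mul_inner, Finset.mul_sum]
    exact Finset.sum_congr rfl fun i _ => by rw [inner_sub_right]; ring
  have hm : ∀ i, StronglyMeasurable[S.ℱ s] fun ω => ψ ω * ⟪H ω, e i⟫ := fun i =>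
    hψm.mul (hHm.inner stronglyMeasurable_const)
  have hL : ∀ i, MemLp (fun ω => ψ ω * ⟪H ω, e i⟫) 2 P := fun i =>
    MemLp.of_le_mul (c := L) hψ ((hm i).mono (S.ℱ.le s)).aestronglyMeasurable
      (.of_forall fun ω => by
        rw [norm_mul, mul_comm]
        refine mul_le_mul_of_nonneg_right ?_ (norm_nonneg _)
        refine (norm_inner_le_norm _ _).trans ?_
        rw [e.norm_eq_one i, mul_one]
        exact hH ω)
  have hmem : ∀ i r, 0 ≤ r → MemLp (fun ω => ⟪e i, S.martPath ξ ω r⟫) 2 P := fun i r hr => by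
    have := S.memLp_inner_martPath ξ (e.norm_eq_one i) r
    simpa only [max_eq_left hr] using this
  simp_rw [hexp]
  rw [integral_finsetSum]
  · refine Finset.sum_eq_zero fun i _ => ?_
    have := integral_mul_martingale_increment (S.martingale_inner ξ (e i)) hst
      (S.memLp_inner_martPath ξ (e.norm_eq_one i) s) (S.memLp_inner_martPath ξ (e.norm_eq_one i) t)
      (hm i) (hL i)
    simpa only [max_eq_left hs, max_eq_left ht] using this
  · exact fun i _ => (hL i).integrable_mul ((hmem i t ht).sub (hmem i s hs))

/-- Conditional variance bound for the martingale part. -/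
theorem PathSDE.exists_setIntegral_sq_increment_le (S : PathSDE d r₀ Ω P) : ∃ K : ℝ, 0 < K ∧
    ∀ (ξ : Seg d r₀) (s t : ℝ), 0 ≤ s → s ≤ t → ∀ D : Set Ω, MeasurableSet[S.ℱ s] D →
      ∫ ω in D, ‖S.martPath ξ ω t - S.martPath ξ ω s‖ ^ 2 ∂P ≤ K * (t - s) * P.real D := by
  have := S.hP
  obtain ⟨C, hC0, hC⟩ := S.exists_comp_bound
  refine ⟨d * C + 1, by positivity, fun ξ s t hs hst D hD => ?_⟩
  set e := EuclideanSpace.basisFun (Fin d) ℝ with he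
  have ht : 0 ≤ t := hs.trans hst
  have hexp : ∀ ω, ‖S.martPath ξ ω t - S.martPath ξ ω s‖ ^ 2
      = ∑ i, (⟪e i, S.martPath ξ ω t⟫ - ⟪e i, S.martPath ξ ω s⟫) ^ 2 := by
    intro ω
    rw [← e.sum_sq_norm_inner_right]
    exact Finset.sum_congr rfl fun i _ => by rw [inner_sub_right, Real.norm_eq_abs, sq_abs]
  have hmem : ∀ i r, 0 ≤ r → MemLp (fun ω => ⟪e i, S.martPath ξ ω r⟫) 2 P := fun i r hr => by
    have := S.memLp_inner_martPath ξ (e.norm_eq_one i) r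
    simpa only [max_eq_left hr] using this
  simp_rw [hexp]
  rw [integral_finsetSum]
  · have hi : ∀ i, ∫ ω in D, (⟪e i, S.martPath ξ ω t⟫ - ⟪e i, S.martPath ξ ω s⟫) ^ 2 ∂P
        ≤ C * (t - s) * P.real D := fun i => by
      obtain ⟨h1, h2⟩ := hC ξ (e i) (e.norm_eq_one i)
      have := setIntegral_sq_martingale_increment_le (S.martingale_inner ξ (e i))
        (S.martingale_inner_sq ξ (e i)) hst (h1 s) (h1 t) (h2 s t hs hst) hD
      simpa only [max_eq_left hs, max_eq_left ht] using this
    refine (Finset.sum_le_sum fun i _ => hi i).trans ?_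
    have : 0 ≤ (t - s) * P.real D := mul_nonneg (by linarith) measureReal_nonneg
    simp only [Finset.sum_const, Finset.card_univ, Fintype.card_fin, nsmul_eq_mul]
    nlinarith
  · exact fun i _ => ((hmem i t ht).sub (hmem i s hs)).integrable_sq.integrableOn

end Paths

section EnergyEvent

/-- Outside an event of controlled probability, the energy inequality holds with error `7 c` on
every time interval during which `‖Y‖²` stays in `[lo, hi]`. -/
theorem PathSDE.exists_energy_event (S : PathSDE d r₀ Ω P) : ∃ K : ℝ, 0 < K ∧
    ∀ (ξ : Seg d r₀) (T c lo hi q : ℝ), 0 < T → 0 < c → 0 ≤ hi →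
      (∀ t ∈ Icc 0 T, P.real {ω | lo ≤ ‖S.Y ξ ω t‖ ^ 2} ≤ q) →
      ∃ B : Set Ω, P.real B ≤ K * T * (hi / c ^ 2 + 1 / c) * q ∧
        ∀ ω ∉ B, ∀ s t, 0 ≤ s → s ≤ t → t ≤ T →
          (∀ r ∈ Icc s t, lo ≤ ‖S.Y ξ ω r‖ ^ 2 ∧ ‖S.Y ξ ω r‖ ^ 2 ≤ hi) →
          ‖S.Y ξ ω t‖ ^ 2 ≤ ‖S.Y ξ ω s‖ ^ 2
            + (∫ r in s..t, 2 * ⟪S.Y ξ ω r, S.driftPath ξ ω r⟫) + 7 * c := by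
  have := S.hP
  obtain ⟨K, hK, hvar⟩ := S.exists_setIntegral_sq_increment_le
  refine ⟨K, hK, fun ξ T c lo hi q hT hc hhi hq => ?_⟩
  set D : Set (EucSp d) := {x | lo ≤ ‖x‖ ^ 2 ∧ ‖x‖ ^ 2 ≤ hi} with hDdef
  have hDm : MeasurableSet D := by
    have h1 : Continuous fun x : EucSp d => ‖x‖ ^ 2 := by fun_prop
    exact ((isClosed_le continuous_const h1).inter (isClosed_le h1 continuous_const)).measurableSet
  set bad : ℕ → Set Ω := fun n =>
    {ω | ∃ j ≤ n + 1, c ≤ |gridInt (S.Y ξ ω) (S.martPath ξ ω) D (T / (n + 1)) j|} ∪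
    {ω | c ≤ gridQV (S.Y ξ ω) (S.martPath ξ ω) D (T / (n + 1)) (n + 1)} with hbad
  refine ⟨{ω | ∀ᶠ n in atTop, ω ∈ bad n}, measureReal_eventually_mem_le fun n => ?_, ?_⟩
  swap
  · intro ω hω s t hs hst ht hr
    refine energy_inequality_of_frequently (S.hYcont ξ ω) (S.continuous_driftPath ξ ω)
      (S.martPath_sub ξ ω) (D := D) hT hc ?_ hs hst ht hr
    refine Filter.Frequently.mono (not_eventually.1 hω) fun n hn => ?_
    simp only [hbad, mem_union, mem_ofPred_eq, not_or, not_exists, not_and, not_le] at hn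
    exact hn
  set h : ℝ := T / (n + 1) with hh
  have hh0 : 0 < h := by positivity
  have hnh : ((n + 1 : ℕ) : ℝ) * h = T := by rw [hh]; push_cast; field_simp
  have hk0 : ∀ k : ℕ, (0 : ℝ) ≤ k * h := fun k => by positivity
  have hk0' : ∀ k : ℕ, (0 : ℝ) ≤ (k + 1) * h := fun k => by positivity
  have hk1 : ∀ k : ℕ, (k : ℝ) * h ≤ (k + 1) * h := fun k => by nlinarith
  let 𝒢 : Filtration ℕ mΩ := ⟨fun k => S.ℱ (k * h), fun i j hij =>
    S.ℱ.mono (mul_le_mul_of_nonneg_right (by exact_mod_cast hij) hh0.le), fun k => S.ℱ.le _⟩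
  set A : ℕ → Set Ω := fun k => {ω | S.Y ξ ω (k * h) ∈ D} with hA
  have hAm : ∀ k : ℕ, MeasurableSet[S.ℱ (k * h)] (A k) := fun k =>
    (S.stronglyMeasurable_Y ξ (hk0 k)).measurable hDm
  have hAm' : ∀ k, MeasurableSet (A k) := fun k => S.ℱ.le _ _ (hAm k)
  have hAq : ∀ k < n + 1, P.real (A k) ≤ q := fun k hk => by
    refine (measureReal_mono fun ω hω => ?_).trans (hq (k * h) ⟨hk0 k, ?_⟩)
    · exact hω.1
    · rw [← hnh]
      exact mul_le_mul_of_nonneg_right (by exact_mod_cast hk.le) hh0.le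
  set H : ℕ → Ω → EucSp d := fun k ω => D.indicator id (S.Y ξ ω (k * h)) with hH
  set Δ : ℕ → Ω → EucSp d := fun k ω =>
    S.martPath ξ ω ((k + 1) * h) - S.martPath ξ ω (k * h) with hΔ
  have hHm : ∀ k : ℕ, StronglyMeasurable[S.ℱ (k * h)] (H k) := fun k =>
    ((stronglyMeasurable_id.indicator hDm).comp_measurable
      (S.stronglyMeasurable_Y ξ (hk0 k)).measurable)
  have hHsq : ∀ k ω, ‖H k ω‖ ^ 2 ≤ hi := fun k ω => by
    by_cases hω : S.Y ξ ω (k * h) ∈ D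
    · simp only [hH, indicator_of_mem hω]; exact hω.2
    · simpa [hH, indicator_of_notMem hω] using hhi
  have hHn : ∀ k ω, ‖H k ω‖ ≤ √hi := fun k ω => Real.le_sqrt_of_sq_le (hHsq k ω)
  have hΔ2 : ∀ k, MemLp (Δ k) 2 P := fun k =>
    (S.memLp_martPath ξ (hk0' k)).sub (S.memLp_martPath ξ (hk0 k))
  have hΔsq : ∀ k, Integrable (fun ω => ‖Δ k ω‖ ^ 2) P := fun k => (hΔ2 k).norm.integrable_sq
  have hΔm : ∀ k : ℕ, StronglyMeasurable[S.ℱ ((k + 1) * h)] (Δ k) := fun k =>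
    (S.stronglyMeasurable_martPath ξ (hk0' k)).sub
      ((S.stronglyMeasurable_martPath ξ (hk0 k)).mono (S.ℱ.mono (hk1 k)))
  have hcell : ∀ k < n + 1, ∫ ω in A k, ‖Δ k ω‖ ^ 2 ∂P ≤ K * h * q := fun k hk => by
    refine (hvar ξ _ _ (hk0 k) (hk1 k) (A k) (hAm k)).trans ?_
    rw [show ((k : ℝ) + 1) * h - k * h = h by ring]
    exact mul_le_mul_of_nonneg_left (hAq k hk) (by positivity)
  have hζm : ∀ k : ℕ, StronglyMeasurable[S.ℱ ((k + 1) * h)] fun ω => ⟪H k ω, Δ k ω⟫ := fun k =>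
    ((hHm k).mono (S.ℱ.mono (hk1 k))).inner (hΔm k)
  have hζ2 : ∀ k, MemLp (fun ω => ⟪H k ω, Δ k ω⟫) 2 P := fun k =>
    MemLp.of_le_mul (c := √hi) (hΔ2 k) ((hζm k).mono (S.ℱ.le _)).aestronglyMeasurable
      (.of_forall fun ω => (norm_inner_le_norm _ _).trans
        (mul_le_mul_of_nonneg_right (hHn k ω) (norm_nonneg _)))
  have hζvar : ∀ k < n + 1, ∫ ω, ⟪H k ω, Δ k ω⟫ ^ 2 ∂P ≤ hi * (K * h * q) := fun k hk => by
    have h1 : ∫ ω, ⟪H k ω, Δ k ω⟫ ^ 2 ∂P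
        ≤ ∫ ω, hi * (A k).indicator (fun ω => ‖Δ k ω‖ ^ 2) ω ∂P := by
      refine integral_mono (hζ2 k).integrable_sq (((hΔsq k).indicator (hAm' k)).const_mul hi)
        fun ω => ?_
      by_cases hω : ω ∈ A k
      · simp only [indicator_of_mem hω]
        have h2 := abs_real_inner_le_norm (H k ω) (Δ k ω)
        calc ⟪H k ω, Δ k ω⟫ ^ 2 = |⟪H k ω, Δ k ω⟫| ^ 2 := (sq_abs _).symm
          _ ≤ (‖H k ω‖ * ‖Δ k ω‖) ^ 2 := pow_le_pow_left₀ (abs_nonneg _) h2 2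
          _ = ‖H k ω‖ ^ 2 * ‖Δ k ω‖ ^ 2 := mul_pow _ _ _
          _ ≤ hi * ‖Δ k ω‖ ^ 2 := mul_le_mul_of_nonneg_right (hHsq k ω) (sq_nonneg _)
      · have h3 : H k ω = 0 :=
          indicator_of_notMem (show S.Y ξ ω (k * h) ∉ D from hω) _
        simp [indicator_of_notMem hω, h3]
    rw [integral_const_mul, integral_indicator (hAm' k)] at h1
    exact h1.trans (mul_le_mul_of_nonneg_left (hcell k hk) hhi)
  have hI := measureReal_exists_abs_sum_ge_le (P := P) (𝒢 := 𝒢) (ζ := fun k ω => ⟪H k ω, Δ k ω⟫)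
    (fun k => by
      have := hζm k
      rw [show ((k : ℝ) + 1) * h = ((k + 1 : ℕ) : ℝ) * h by push_cast; ring] at this
      exact this)
    hζ2 (fun k ψ hψm hψ => S.integral_mul_inner_increment ξ (hk0 k) (hk1 k) (hHm k) (hHn k) hψm hψ)
    (n + 1) hζvar hc
  have hQ : P.real {ω | c ≤ gridQV (S.Y ξ ω) (S.martPath ξ ω) D h (n + 1)} ≤ K * T * q / c := by
    have hrew : ∀ ω, gridQV (S.Y ξ ω) (S.martPath ξ ω) D h (n + 1)
        = ∑ k ∈ Finset.range (n + 1), (A k).indicator (fun ω => ‖Δ k ω‖ ^ 2) ω := fun ω => by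
      refine Finset.sum_congr rfl fun k _ => ?_
      by_cases hω : ω ∈ A k
      · rw [indicator_of_mem hω, indicator_of_mem (show S.Y ξ ω (k * h) ∈ D from hω), one_mul]
      · rw [indicator_of_notMem hω, indicator_of_notMem (show S.Y ξ ω (k * h) ∉ D from hω),
          zero_mul]
    have hInt : ∀ k ∈ Finset.range (n + 1),
        Integrable ((A k).indicator fun ω => ‖Δ k ω‖ ^ 2) P :=
      fun k _ => (hΔsq k).indicator (hAm' k)
    have h1 := mul_meas_ge_le_integral_of_nonneg (μ := P)
      (f := fun ω => gridQV (S.Y ξ ω) (S.martPath ξ ω) D h (n + 1))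
      (.of_forall fun ω => gridQV_nonneg _ _ _ _ _)
      (by simp_rw [hrew]; exact integrable_finsetSum _ hInt) c
    have h2 : ∫ ω, gridQV (S.Y ξ ω) (S.martPath ξ ω) D h (n + 1) ∂P ≤ K * T * q := by
      simp_rw [hrew]
      rw [integral_finsetSum _ hInt]
      calc ∑ k ∈ Finset.range (n + 1), ∫ ω, (A k).indicator (fun ω => ‖Δ k ω‖ ^ 2) ω ∂P
          ≤ ∑ k ∈ Finset.range (n + 1), K * h * q := Finset.sum_le_sum fun k hk => by
            rw [integral_indicator (hAm' k)]; exact hcell k (Finset.mem_range.1 hk)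
        _ = K * T * q := by
            rw [Finset.sum_const, Finset.card_range, nsmul_eq_mul, ← hnh]; ring
    rw [le_div_iff₀ hc, mul_comm]
    exact h1.trans h2
  refine (measureReal_union_le _ _).trans ((add_le_add hI hQ).trans (le_of_eq ?_))
  rw [show ((n + 1 : ℕ) : ℝ) * (hi * (K * h * q)) = hi * K * q * (((n + 1 : ℕ) : ℝ) * h) by ring,
    hnh]
  ring

end EnergyEvent

section Dissipativity

theorem PathSDE.norm_segPath_le (S : PathSDE d r₀ Ω P) (ξ : Seg d r₀) (ω : Ω) {r B : ℝ}
    (hB : 0 ≤ B) (h : ∀ q ∈ Icc (r - r₀) r, ‖S.Y ξ ω q‖ ^ 2 ≤ B) :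
    ‖S.segPath ξ ω r‖ ^ 2 ≤ B := by
  have h1 : ‖S.segPath ξ ω r‖ ≤ √B := by
    rw [ContinuousMap.norm_le _ (Real.sqrt_nonneg B)]
    intro θ
    have hθ : S.segPath ξ ω r θ = S.Y ξ ω (r + θ.1) := rfl
    rw [hθ]
    exact Real.le_sqrt_of_sq_le (h _ ⟨by linarith [θ.2.1], by linarith [θ.2.2]⟩)
  calc ‖S.segPath ξ ω r‖ ^ 2 ≤ √B ^ 2 := pow_le_pow_left₀ (norm_nonneg _) h1 2
    _ = B := Real.sq_sqrt hB

/-- Dissipativity of the drift for histories below a large level `B`. -/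
theorem PathSDE.exists_drift_le (S : PathSDE d r₀ Ω P) : ∃ l ρ L₀ : ℝ, 0 < l ∧ 0 < ρ ∧ ρ < 1 ∧
    0 < L₀ ∧ ∀ (ξ : Seg d r₀) (ω : Ω), ∀ B ≥ L₀, ∀ r : ℝ,
      (∀ q ∈ Icc (r - r₀) r, ‖S.Y ξ ω q‖ ^ 2 ≤ B) →
      2 * ⟪S.Y ξ ω r, S.driftPath ξ ω r⟫ ≤ -l * (‖S.Y ξ ω r‖ ^ 2 - ρ * B) := by
  obtain ⟨l₁, l₂, h₁, h₂, h₁₂, hdiss⟩ := S.hA2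
  have hlt : l₂ < l₁ := by
    have : 1 ≤ Real.exp (l₁ * r₀) := Real.one_le_exp (by have := S.hr₀; positivity)
    nlinarith
  set κ := (l₁ - l₂) / 2 with hκ
  have hκ0 : 0 < κ := by rw [hκ]; linarith
  set m := ‖S.b 0‖ with hm
  have hm0 : 0 ≤ m := norm_nonneg _
  refine ⟨l₁, (l₂ + κ) / l₁, (2 * m / κ) ^ 2 + 1, h₁, by positivity,
    (div_lt_one h₁).2 (by rw [hκ]; linarith), by positivity, fun ξ ω B hB r hr => ?_⟩
  have hB0 : 0 ≤ B := by have := sq_nonneg (2 * m / κ); linarith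
  have hseg := S.norm_segPath_le ξ ω hB0 hr
  have hev : ev0 S.hr₀ (S.segPath ξ ω r) = S.Y ξ ω r := by
    change S.Y ξ ω (r + 0) = _
    rw [add_zero]
  have hd := hdiss (S.segPath ξ ω r) 0
  have hev' : ev0 S.hr₀ (0 : Seg d r₀) = 0 := rfl
  rw [hev', sub_zero, sub_zero, hev, inner_sub_right] at hd
  have hY : ‖S.Y ξ ω r‖ ≤ √B :=
    Real.le_sqrt_of_sq_le (hr r ⟨by linarith [S.hr₀], le_rfl⟩)
  have hin : 2 * ⟪S.Y ξ ω r, S.b 0⟫ ≤ κ * B := by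
    have h3 : ⟪S.Y ξ ω r, S.b 0⟫ ≤ √B * m :=
      (real_inner_le_norm _ _).trans (mul_le_mul_of_nonneg_right hY hm0)
    have h4 : 2 * m / κ ≤ √B := Real.le_sqrt_of_sq_le (by linarith)
    have h5 : 2 * m ≤ √B * κ := (div_le_iff₀ hκ0).1 h4
    have h6 := Real.sq_sqrt hB0
    nlinarith [Real.sqrt_nonneg B]
  have hl : l₁ * ((l₂ + κ) / l₁ * B) = (l₂ + κ) * B := by field_simp
  have h7 : l₂ * ‖S.segPath ξ ω r‖ ^ 2 ≤ l₂ * B := mul_le_mul_of_nonneg_left hseg h₂.le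
  have h8 : S.driftPath ξ ω r = S.b (S.segPath ξ ω r) := rfl
  rw [h8]
  linarith

end Dissipativity

section Tails

/-- The event that `‖Y‖²` reaches level `a` during `[0, T]`. -/
def PathSDE.hitSet (S : PathSDE d r₀ Ω P) (ξ : Seg d r₀) (T a : ℝ) : Set Ω :=
  {ω | ∃ r ∈ Icc 0 T, a ≤ ‖S.Y ξ ω r‖ ^ 2}

theorem PathSDE.sq_norm_Y_le (S : PathSDE d r₀ Ω P) (ξ : Seg d r₀) (ω : Ω) {q : ℝ}
    (hq : q ∈ Icc (-r₀) 0) : ‖S.Y ξ ω q‖ ^ 2 ≤ ‖ξ‖ ^ 2 := by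
  rw [S.hY0 ξ ω ⟨q, hq⟩]
  exact pow_le_pow_left₀ (norm_nonneg _) (ξ.norm_coe_le_norm _) 2

theorem PathSDE.setOf_le_sq_norm_X_subset (S : PathSDE d r₀ Ω P) {ξ : Seg d r₀} {t T L : ℝ}
    (ht : t ∈ Icc 0 T) (hL : ‖ξ‖ ^ 2 < L) :
    {ω | L ≤ ‖S.X ξ t ω‖ ^ 2} ⊆ S.hitSet ξ T L := by
  intro ω hω
  by_contra hhit
  have hlt : ∀ r ∈ Icc 0 T, ‖S.Y ξ ω r‖ ^ 2 < L := fun r hr =>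
    not_le.1 fun h => hhit ⟨r, hr, h⟩
  have hL0 : 0 < L := (sq_nonneg _).trans_lt hL
  have hX : ‖S.X ξ t ω‖ < √L := by
    rw [ContinuousMap.norm_lt_iff _ (Real.sqrt_pos.2 hL0)]
    intro θ
    rw [S.hX ξ t ht.1 ω θ]
    refine Real.lt_sqrt_of_sq_lt ?_
    rcases le_total 0 (t + θ.1) with h0 | h0
    · exact hlt _ ⟨h0, by linarith [θ.2.2, ht.2]⟩
    · exact (S.sq_norm_Y_le ξ ω ⟨by linarith [θ.2.1, ht.1], h0⟩).trans_lt hL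
  have h1 : ‖S.X ξ t ω‖ ^ 2 < L := by
    calc ‖S.X ξ t ω‖ ^ 2 < √L ^ 2 := pow_lt_pow_left₀ hX (norm_nonneg _) two_ne_zero
      _ = L := Real.sq_sqrt hL0.le
  exact absurd hω (not_le.2 h1)

/-- Reaching a high level is much less likely than reaching a fixed fraction of it. -/
theorem PathSDE.exists_measureReal_hitSet_le (S : PathSDE d r₀ Ω P) {T : ℝ} (hT : 0 < T) :
    ∃ C ρ L₀ : ℝ, 0 < C ∧ 0 < ρ ∧ ρ < 1 ∧ 0 < L₀ ∧ ∀ (ξ : Seg d r₀), ∀ L ≥ L₀,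
      ‖ξ‖ ^ 2 ≤ ρ * L → P.real (S.hitSet ξ T L) ≤ C / L * P.real (S.hitSet ξ T (ρ * L)) := by
  have := S.hP
  obtain ⟨K, hK, hen⟩ := S.exists_energy_event
  obtain ⟨l, ρ, L₀, hl, hρ, hρ1, hL₀, hdr⟩ := S.exists_drift_le
  have hρ' : 0 < 1 - ρ := by linarith
  refine ⟨K * T * (196 / (1 - ρ) ^ 2 + 14 / (1 - ρ)), ρ, L₀, by positivity, hρ, hρ1, hL₀,
    fun ξ L hL hξ => ?_⟩
  have hL0 : 0 < L := hL₀.trans_le hL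
  obtain ⟨B, hB, hBc⟩ := hen ξ T ((1 - ρ) * L / 14) (ρ * L) L (P.real (S.hitSet ξ T (ρ * L))) hT
    (by positivity) hL0.le (fun t ht => measureReal_mono fun ω hω => ⟨t, ht, hω⟩)
  have hsub : S.hitSet ξ T L ⊆ B := by
    intro ω hω
    by_contra hωB
    obtain ⟨r, hr, hr'⟩ := hω
    have hd := S.continuous_driftPath ξ ω
    have hy := S.hYcont ξ ω
    refine absurd hr' (not_le.2 (stays_below_of_drift_nonpos (g := fun r => ‖S.Y ξ ω r‖ ^ 2)
      (f := fun r => 2 * ⟪S.Y ξ ω r, S.driftPath ξ ω r⟫) (by fun_prop) (by fun_prop)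
      S.hr₀.le (ρ := ρ) (by nlinarith) (δ := 7 * ((1 - ρ) * L / 14)) (by nlinarith)
      (hBc ω hωB) ?_ ?_ r hr))
    · intro r _ hhist hlow
      have := hdr ξ ω L hL r hhist
      nlinarith
    · exact fun q hq => (S.sq_norm_Y_le ξ ω hq).trans hξ
  refine (measureReal_mono hsub).trans (hB.trans (le_of_eq ?_))
  field_simp
  ring

end Tails

section Moments

/-- Moments of a nonnegative random variable with geometrically decaying tails. -/
theorem integrable_rpow_and_integral_le_of_geometric_tail [IsProbabilityMeasure P] {N : Ω → ℝ}
    (hN : Measurable N) (hN0 : ∀ ω, 0 ≤ N ω) {M θ s : ℝ} (hM : 0 < M) (hθ : 1 < θ) (hs : 0 < s)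
    (htail : ∀ n : ℕ, P.real {ω | M * θ ^ n ≤ N ω} ≤ ((θ ^ s)⁻¹ / 2) ^ n) :
    Integrable (fun ω => N ω ^ s) P ∧ ∫ ω, N ω ^ s ∂P ≤ M ^ s * (1 + 2 * θ ^ s) := by
  have hθ0 : 0 < θ := one_pos.trans hθ
  set w : ℝ := θ ^ s with hw
  have hw0 : 0 < w := Real.rpow_pos_of_pos hθ0 s
  have hMs : 0 < M ^ s := Real.rpow_pos_of_pos hM s
  have hpow : ∀ n : ℕ, (M * θ ^ n) ^ s = M ^ s * w ^ n := fun n => by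
    rw [Real.mul_rpow hM.le (by positivity), ← Real.rpow_natCast θ n, ← Real.rpow_mul hθ0.le,
      mul_comm (n : ℝ), Real.rpow_mul hθ0.le, Real.rpow_natCast]
  have hset : ∀ n : ℕ, MeasurableSet {ω | M * θ ^ n ≤ N ω} := fun n =>
    measurableSet_le measurable_const hN
  have hptw : ∀ ω, ENNReal.ofReal (N ω ^ s) ≤ ENNReal.ofReal (M ^ s) +
      ∑' n : ℕ, {ω | M * θ ^ n ≤ N ω}.indicator
        (fun _ => ENNReal.ofReal (M ^ s * w ^ (n + 1))) ω := fun ω => by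
    rcases lt_or_ge (N ω) M with h | h
    · exact (ENNReal.ofReal_le_ofReal (Real.rpow_le_rpow (hN0 ω) h.le hs.le)).trans le_self_add
    · obtain ⟨n, hn, hn'⟩ := exists_nat_pow_near ((one_le_div hM).2 h) hθ
      have h1 : M * θ ^ n ≤ N ω := by rwa [le_div_iff₀ hM, mul_comm] at hn
      have h2 : N ω ≤ M * θ ^ (n + 1) := by
        rw [div_lt_iff₀ hM, mul_comm] at hn'; exact hn'.le
      refine le_trans ?_ le_add_self
      refine le_trans ?_ (ENNReal.le_tsum n)
      rw [indicator_of_mem (show ω ∈ {ω | M * θ ^ n ≤ N ω} from h1), ← hpow]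
      exact ENNReal.ofReal_le_ofReal (Real.rpow_le_rpow (hN0 ω) h2 hs.le)
  have hlin : ∫⁻ ω, ENNReal.ofReal (N ω ^ s) ∂P ≤ ENNReal.ofReal (M ^ s * (1 + 2 * w)) := by
    refine (lintegral_mono hptw).trans ?_
    rw [lintegral_add_left measurable_const, lintegral_const, measure_univ, mul_one,
      lintegral_tsum fun n => (measurable_const.indicator (hset n)).aemeasurable]
    have hterm : ∀ n : ℕ, ∫⁻ ω, {ω | M * θ ^ n ≤ N ω}.indicator
        (fun _ => ENNReal.ofReal (M ^ s * w ^ (n + 1))) ω ∂P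
        ≤ ENNReal.ofReal (M ^ s * w * (1 / 2) ^ n) := fun n => by
      rw [lintegral_indicator_const (hset n), ← ofReal_measureReal, ← ENNReal.ofReal_mul
        (by positivity)]
      refine ENNReal.ofReal_le_ofReal ((mul_le_mul_of_nonneg_left (htail n)
        (by positivity)).trans (le_of_eq ?_))
      rw [div_pow, inv_pow, one_div, inv_pow, pow_succ]
      field_simp
    refine (add_le_add_right (ENNReal.tsum_le_tsum hterm) _).trans (le_of_eq ?_)
    rw [← ENNReal.ofReal_tsum_of_nonneg (fun n => by positivity)
      (summable_geometric_two.mul_left _), tsum_mul_left, tsum_geometric_two,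
      ← ENNReal.ofReal_add hMs.le (by positivity)]
    congr 1
    ring
  have hmeas : AEStronglyMeasurable (fun ω => N ω ^ s) P :=
    (hN.pow_const s).aestronglyMeasurable
  have hnn : 0 ≤ᵐ[P] fun ω => N ω ^ s := .of_forall fun ω => Real.rpow_nonneg (hN0 ω) s
  refine ⟨⟨hmeas, ?_⟩, ?_⟩
  · rw [hasFiniteIntegral_iff_ofReal hnn]
    exact hlin.trans_lt ENNReal.ofReal_lt_top
  · rw [integral_eq_lintegral_of_nonneg_ae hnn hmeas]
    exact ENNReal.toReal_le_of_le_ofReal (by positivity) hlin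

theorem PathSDE.measurable_norm_X (S : PathSDE d r₀ Ω P) (ξ : Seg d r₀) {t : ℝ} (ht : 0 ≤ t) :
    Measurable fun ω => ‖S.X ξ t ω‖ :=
  ((S.hXadapted ξ t ht).mono (S.ℱ.le t)).norm.measurable

/-- Moment bounds on bounded time intervals. -/
theorem PathSDE.exists_moment_le (S : PathSDE d r₀ Ω P) {p T : ℝ} (hp : 0 < p) (hT : 0 < T) :
    ∃ C : ℝ, 0 < C ∧ ∀ (ξ : Seg d r₀), ∀ t ∈ Icc 0 T,
      Integrable (fun ω => ‖S.X ξ t ω‖ ^ p) P ∧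
        ∫ ω, ‖S.X ξ t ω‖ ^ p ∂P ≤ C * (1 + ‖ξ‖ ^ p) := by
  have := S.hP
  obtain ⟨C, ρ, L₀, hC, hρ, hρ1, hL₀, hhit⟩ := S.exists_measureReal_hitSet_le hT
  set θ : ℝ := ρ⁻¹ with hθ
  have hθ1 : 1 < θ := (one_lt_inv₀ hρ).2 hρ1
  have hθ0 : 0 < θ := one_pos.trans hθ1
  set s : ℝ := p / 2 with hs
  have hs0 : 0 < s := by positivity
  set a : ℝ := (θ ^ s)⁻¹ / 2 with ha
  have hw0 : 0 < θ ^ s := Real.rpow_pos_of_pos hθ0 s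
  have ha0 : 0 < a := by positivity
  set L₁ : ℝ := max L₀ (C / a) with hL₁
  have hL₁0 : 0 < L₁ := hL₀.trans_le (le_max_left _ _)
  have hrpow : ∀ x : ℝ, 0 ≤ x → (x ^ 2) ^ s = x ^ p := fun x hx => by
    rw [← Real.rpow_natCast, ← Real.rpow_mul hx, hs]
    congr 1
    push_cast
    ring
  refine ⟨(L₁ ^ s + θ ^ s) * (1 + 2 * θ ^ s), by positivity, fun ξ t ht => ?_⟩
  set M : ℝ := max L₁ (‖ξ‖ ^ 2 * θ) with hM
  have hM0 : 0 < M := hL₁0.trans_le (le_max_left _ _)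
  have hξM : ‖ξ‖ ^ 2 < M := by
    rcases (sq_nonneg ‖ξ‖).eq_or_lt with h | h
    · rw [← h]; exact hM0
    · exact (lt_mul_of_one_lt_right h hθ1).trans_le (le_max_right _ _)
  have hMn : ∀ n : ℕ, M ≤ M * θ ^ n := fun n =>
    le_mul_of_one_le_right hM0.le (one_le_pow₀ hθ1.le)
  have hF : ∀ n : ℕ, P.real (S.hitSet ξ T (M * θ ^ n)) ≤ a ^ n := fun n => by
    induction n with
    | zero => rw [pow_zero]; exact measureReal_le_one
    | succ n ih =>
      have h1 : ρ * (M * θ ^ (n + 1)) = M * θ ^ n := by rw [hθ, pow_succ]; field_simp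
      have h2 := hhit ξ (M * θ ^ (n + 1))
        ((le_max_left _ _).trans ((le_max_left _ _).trans (hMn _)))
        (by rw [h1]; exact hξM.le.trans (hMn n))
      rw [h1] at h2
      refine h2.trans ?_
      rw [pow_succ' a]
      refine mul_le_mul ?_ ih measureReal_nonneg ha0.le
      rw [div_le_iff₀ (hM0.trans_le (hMn _)), ← div_le_iff₀' ha0]
      exact (le_max_right _ _).trans ((le_max_left _ _).trans (hMn _))
  have hX := integrable_rpow_and_integral_le_of_geometric_tail (P := P)
    (N := fun ω => ‖S.X ξ t ω‖ ^ 2) ((S.measurable_norm_X ξ ht.1).pow_const 2)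
    (fun ω => sq_nonneg _) hM0 hθ1 hs0 fun n =>
      (measureReal_mono (S.setOf_le_sq_norm_X_subset ht (hξM.trans_le (hMn n)))).trans (hF n)
  simp only [hrpow _ (norm_nonneg _)] at hX
  refine ⟨hX.1, hX.2.trans ?_⟩
  have hMs : M ^ s ≤ L₁ ^ s + θ ^ s * ‖ξ‖ ^ p := by
    have h3 : (‖ξ‖ ^ 2 * θ) ^ s = θ ^ s * ‖ξ‖ ^ p := by
      rw [Real.mul_rpow (by positivity) hθ0.le, hrpow _ (norm_nonneg _), mul_comm]
    have h4 : 0 ≤ ‖ξ‖ ^ p := Real.rpow_nonneg (norm_nonneg _) p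
    rcases max_choice L₁ (‖ξ‖ ^ 2 * θ) with h | h
    · rw [hM, h]; exact le_add_of_nonneg_right (by positivity)
    · rw [hM, h, h3]; exact le_add_of_nonneg_left (by positivity)
  have h4 : 0 ≤ ‖ξ‖ ^ p := Real.rpow_nonneg (norm_nonneg _) p
  have h5 : L₁ ^ s + θ ^ s * ‖ξ‖ ^ p ≤ (L₁ ^ s + θ ^ s) * (1 + ‖ξ‖ ^ p) := by
    have : 0 ≤ L₁ ^ s := by positivity
    nlinarith
  calc M ^ s * (1 + 2 * θ ^ s) ≤ (L₁ ^ s + θ ^ s) * (1 + ‖ξ‖ ^ p) * (1 + 2 * θ ^ s) :=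
        mul_le_mul_of_nonneg_right (hMs.trans h5) (by positivity)
    _ = (L₁ ^ s + θ ^ s) * (1 + 2 * θ ^ s) * (1 + ‖ξ‖ ^ p) := by ring

end Moments

section Contraction

/-- After a suitable fixed time, the norm of a large segment is halved with high probability. -/
theorem PathSDE.exists_measureReal_half_lt_le (S : PathSDE d r₀ Ω P) :
    ∃ T R₀ C : ℝ, 0 < T ∧ 0 < R₀ ∧ 0 < C ∧ ∀ ξ : Seg d r₀, R₀ ≤ ‖ξ‖ →
      P.real {ω | ‖ξ‖ / 2 < ‖S.X ξ T ω‖} ≤ C / ‖ξ‖ ^ 2 := by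
  have := S.hP
  obtain ⟨K, hK, hen⟩ := S.exists_energy_event
  obtain ⟨l, ρ, L₀, hl, hρ, hρ1, hL₀, hdr⟩ := S.exists_drift_le
  have hr := S.hr₀
  set ε : ℝ := (1 - ρ) / 4 with hε
  have hε0 : 0 < ε := by rw [hε]; linarith
  set γ : ℝ := ρ + 2 * ε with hγ
  have hγ0 : 0 < γ := by positivity
  have hγ1 : γ < 1 := by rw [hγ, hε]; linarith
  obtain ⟨k, hk⟩ := exists_pow_lt_of_lt_one (show 0 < ρ / 4 by positivity) hγ1
  have hk0 : k ≠ 0 := by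
    rintro rfl
    rw [pow_zero] at hk
    linarith
  have hk1 : γ ^ k ≤ 1 := pow_le_one₀ hγ0.le hγ1.le
  set τ : ℝ := 1 / (l * ε) with hτ
  have hτ0 : 0 < τ := by positivity
  have hkpos : (0 : ℝ) < k := by exact_mod_cast Nat.pos_of_ne_zero hk0
  set T : ℝ := k * (τ + r₀) with hT
  have hT0 : 0 < T := by positivity
  set e : ℝ := ε * γ ^ k / 7 with he
  have he0 : 0 < e := by positivity
  refine ⟨T, max 1 (L₀ * ρ / γ ^ k), K * T * (1 / e ^ 2 + 1 / e) * ρ, hT0,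
    lt_max_of_lt_left one_pos, by positivity, fun ξ hξ => ?_⟩
  have hR1 : 1 ≤ ‖ξ‖ := (le_max_left _ _).trans hξ
  have hR : 0 < ‖ξ‖ := one_pos.trans_le hR1
  set L : ℝ := ‖ξ‖ ^ 2 / ρ with hL
  have hL0 : 0 < L := by positivity
  have hρL : ρ * L = ‖ξ‖ ^ 2 := by rw [hL]; field_simp
  have hL₀L : L₀ ≤ γ ^ k * L := by
    have h1 : L₀ * ρ / γ ^ k ≤ ‖ξ‖ ^ 2 :=
      ((le_max_right _ _).trans hξ).trans (by nlinarith)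
    rw [div_le_iff₀ (by positivity)] at h1
    rw [hL, ← mul_div_assoc, le_div_iff₀ hρ]
    linarith
  obtain ⟨B, hB, hBc⟩ := hen ξ T (e * L) 0 L 1 hT0 (by positivity) hL0.le
    (fun t _ => measureReal_le_one)
  have hsub : {ω | ‖ξ‖ / 2 < ‖S.X ξ T ω‖} ⊆ B := by
    intro ω hω
    by_contra hωB
    have hd := S.continuous_driftPath ξ ω
    have hy := S.hYcont ξ ω
    have hg : Continuous fun r => ‖S.Y ξ ω r‖ ^ 2 := by fun_prop
    have hf : Continuous fun r => 2 * ⟪S.Y ξ ω r, S.driftPath ξ ω r⟫ := by fun_prop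
    have hδ : 7 * (e * L) = ε * (γ ^ k * L) := by rw [he]; ring
    have hLL : L₀ ≤ L := hL₀L.trans (mul_le_of_le_one_left hL0.le hk1)
    have h0 : ∀ q ∈ Icc (-r₀) 0, ‖S.Y ξ ω q‖ ^ 2 ≤ ρ * L := fun q hq => by
      rw [hρL]; exact S.sq_norm_Y_le ξ ω hq
    have hbelow := stays_below_of_drift_nonpos hg hf hr.le (T := T) (L := L) (ρ := ρ)
      (δ := 7 * (e * L)) (by nlinarith)
      (by
        rw [hδ]
        have h1 : ε * (γ ^ k * L) ≤ ε * L :=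
          mul_le_mul_of_nonneg_left (mul_le_of_le_one_left hL0.le hk1) hε0.le
        have h2 : ε * L * 4 = L - ρ * L := by rw [hε]; ring
        nlinarith [mul_pos hε0 hL0])
      (fun s t hs hst ht h => hBc ω hωB s t hs hst ht fun r hr => ⟨sq_nonneg _, (h r hr).2⟩)
      (fun r _ hhist hlow => by
        have := hdr ξ ω L hLL r hhist
        nlinarith) h0
    have hhist : ∀ q ∈ Icc (-r₀) T, ‖S.Y ξ ω q‖ ^ 2 ≤ L := fun q hq => by
      rcases le_total q 0 with h | h
      · exact (h0 q ⟨hq.1, h⟩).trans (by nlinarith)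
      · exact (hbelow q ⟨h, hq.2⟩).le
    have hrel := relaxation_iterate hg hf (T := T) (L₀ := L₀) (L := L) (ρ := ρ)
      (δ := 7 * (e * L)) (l := l) (ε := ε) (τ := τ) hr.le hl hε0 hτ0.le
      (by rw [hτ]; field_simp; rfl) hL0 hρ hγ1.le k hδ.le hL₀L
      (fun s t hs hst ht => hBc ω hωB s t hs hst ht fun r hr =>
        ⟨sq_nonneg _, hhist r ⟨by linarith [hr.1], by linarith [hr.2]⟩⟩)
      (fun B hB r _ h => hdr ξ ω B hB r h) hhist
    have hend : ‖S.X ξ T ω‖ ^ 2 ≤ γ ^ k * L := by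
      rw [S.X_eq_segPath ξ ω hT0.le]
      exact S.norm_segPath_le ξ ω (by positivity) hrel
    have hquarter : γ ^ k * L ≤ (‖ξ‖ / 2) ^ 2 := by
      calc γ ^ k * L ≤ ρ / 4 * L := mul_le_mul_of_nonneg_right hk.le hL0.le
        _ = (‖ξ‖ / 2) ^ 2 := by rw [hL]; field_simp; norm_num
    exact absurd hω (not_lt.2 (abs_le_of_sq_le_sq' (hend.trans hquarter) (by positivity)).2)
  refine (measureReal_mono hsub).trans (hB.trans (le_of_eq ?_))
  rw [hL]
  field_simp

/-- A Foster–Lyapunov drift condition for the segment process sampled at a fixed time. -/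
theorem PathSDE.exists_moment_contraction (S : PathSDE d r₀ Ω P) {p : ℝ} (hp : 1 ≤ p) :
    ∃ T A : ℝ, 0 < T ∧ 0 < A ∧ ∀ ξ : Seg d r₀,
      ∫ ω, ‖S.X ξ T ω‖ ^ p ∂P ≤ 3 / 4 * ‖ξ‖ ^ p + A := by
  have := S.hP
  have hp0 : 0 < p := one_pos.trans_le hp
  obtain ⟨T, R₀, C, hT, hR₀, hC, hG⟩ := S.exists_measureReal_half_lt_le
  obtain ⟨C₁, hC₁, h₁⟩ := S.exists_moment_le hp0 hT
  obtain ⟨C₂, hC₂, h₂⟩ := S.exists_moment_le (show 0 < p + p by positivity) hT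
  have hTT : T ∈ Icc 0 T := ⟨hT.le, le_rfl⟩
  set η : ℝ := 1 / (16 * C₂) with hη
  have hη0 : 0 < η := by positivity
  set R₁ : ℝ := max (max 1 R₀) (2 * C / η) with hR₁
  have hR₁0 : 0 < R₁ := lt_max_of_lt_left (lt_max_of_lt_left one_pos)
  refine ⟨T, C₁ * (1 + R₁ ^ p), hT, by positivity, fun ξ => ?_⟩
  rcases le_total ‖ξ‖ R₁ with hle | hge
  · refine (h₁ ξ T hTT).2.trans ?_
    have h3 : ‖ξ‖ ^ p ≤ R₁ ^ p := Real.rpow_le_rpow (norm_nonneg _) hle hp0.le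
    have h4 : 0 ≤ ‖ξ‖ ^ p := Real.rpow_nonneg (norm_nonneg _) p
    nlinarith
  set R : ℝ := ‖ξ‖ with hR
  have hR1 : 1 ≤ R := ((le_max_left _ _).trans (le_max_left _ _)).trans hge
  have hRR₀ : R₀ ≤ R := ((le_max_right _ _).trans (le_max_left _ _)).trans hge
  have hRη : 2 * C / η ≤ R := (le_max_right _ _).trans hge
  have hR0 : 0 < R := one_pos.trans_le hR1
  set y : ℝ := R ^ p with hy
  have hy1 : 1 ≤ y := Real.one_le_rpow hR1 hp0.le
  have hy0 : 0 < y := one_pos.trans_le hy1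
  set G : Set Ω := {ω | R / 2 < ‖S.X ξ T ω‖} with hGdef
  have hGm : MeasurableSet G := measurableSet_lt measurable_const (S.measurable_norm_X ξ hT.le)
  have hhalf : (R / 2) ^ p ≤ y / 2 := by
    rw [Real.div_rpow hR0.le two_pos.le]
    have : (2 : ℝ) ≤ 2 ^ p := by
      calc (2 : ℝ) = 2 ^ (1 : ℝ) := (Real.rpow_one 2).symm
        _ ≤ 2 ^ p := Real.rpow_le_rpow_of_exponent_le one_le_two hp
    exact div_le_div_of_nonneg_left hy0.le two_pos this
  have hptw : ∀ ω, ‖S.X ξ T ω‖ ^ p ≤ y / 2 + η / y * ‖S.X ξ T ω‖ ^ (p + p)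
      + G.indicator (fun _ => y / (4 * η)) ω := fun ω => by
    set x : ℝ := ‖S.X ξ T ω‖ with hx
    have hx0 : 0 ≤ x := norm_nonneg _
    have hxp : 0 ≤ x ^ p := Real.rpow_nonneg hx0 p
    rw [Real.rpow_add_of_nonneg hx0 hp0.le hp0.le]
    by_cases hω : ω ∈ G
    · rw [indicator_of_mem hω]
      have h5 : η / y * (x ^ p * x ^ p) + y / (4 * η) - x ^ p
          = η / y * (x ^ p - y / (2 * η)) ^ 2 := by field_simp; ring
      have h6 : 0 ≤ η / y * (x ^ p - y / (2 * η)) ^ 2 := by positivity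
      linarith
    · rw [indicator_of_notMem hω]
      have h5 : x ^ p ≤ (R / 2) ^ p := Real.rpow_le_rpow hx0 (not_lt.1 hω) hp0.le
      have h6 : 0 ≤ η / y * (x ^ p * x ^ p) := by positivity
      linarith
  have hi2 := (h₂ ξ T hTT).1.const_mul (η / y)
  have hiG : Integrable (G.indicator fun _ => y / (4 * η)) P :=
    (integrable_const _).indicator hGm
  have hInt := integral_mono (h₁ ξ T hTT).1 (((integrable_const (y / 2)).add hi2).add hiG) hptw
  have hsplit : ∫ ω, ((fun _ : Ω => y / 2) + (fun ω => η / y * ‖S.X ξ T ω‖ ^ (p + p))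
      + G.indicator (fun _ => y / (4 * η)) : Ω → ℝ) ω ∂P
      = y / 2 + η / y * ∫ ω, ‖S.X ξ T ω‖ ^ (p + p) ∂P + P.real G * (y / (4 * η)) := by
    rw [integral_add' ((integrable_const (y / 2)).add hi2) hiG,
      integral_add' (integrable_const (y / 2)) hi2, integral_const, integral_const_mul,
      integral_indicator_const _ hGm]
    simp
  have hterm₂ : η / y * ∫ ω, ‖S.X ξ T ω‖ ^ (p + p) ∂P ≤ y / 8 := by
    have h7 := (h₂ ξ T hTT).2
    rw [← hR, Real.rpow_add hR0, ← hy] at h7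
    calc η / y * ∫ ω, ‖S.X ξ T ω‖ ^ (p + p) ∂P ≤ η / y * (C₂ * (2 * (y * y))) := by
          refine mul_le_mul_of_nonneg_left (h7.trans ?_) (by positivity)
          exact mul_le_mul_of_nonneg_left (by nlinarith) hC₂.le
      _ = y / 8 := by rw [hη]; field_simp; norm_num
  have hterm₃ : P.real G * (y / (4 * η)) ≤ y / 8 := by
    have h8 : P.real G ≤ η / 2 := by
      refine (hG ξ hRR₀).trans ?_
      rw [div_le_iff₀ hη0] at hRη
      rw [← hR, div_le_iff₀ (by positivity)]
      nlinarith [mul_pos hη0 hR0]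
    calc P.real G * (y / (4 * η)) ≤ η / 2 * (y / (4 * η)) :=
          mul_le_mul_of_nonneg_right h8 (by positivity)
      _ = y / 8 := by field_simp; norm_num
  have hA : 0 < C₁ * (1 + R₁ ^ p) := by positivity
  rw [hsplit] at hInt
  linarith

end Contraction

section Iteration

/-- The drift condition propagates along the segment process by the Markov property. -/
theorem PathSDE.integral_norm_rpow_add_le (S : PathSDE d r₀ Ω P) {p T A : ℝ} (hp : 0 < p)
    (hT : 0 < T) (hA : ∀ ξ : Seg d r₀, ∫ ω, ‖S.X ξ T ω‖ ^ p ∂P ≤ 3 / 4 * ‖ξ‖ ^ p + A)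
    (ξ : Seg d r₀) {s : ℝ} (hs : 0 ≤ s) :
    ∫ ω, ‖S.X ξ (s + T) ω‖ ^ p ∂P ≤ 3 / 4 * ∫ ω, ‖S.X ξ s ω‖ ^ p ∂P + A := by
  have := S.hP
  have hsT : 0 < s + T := by positivity
  obtain ⟨C, -, hC⟩ := S.exists_moment_le hp hsT
  have hmin : ∀ (n : ℕ) (ζ : Seg d r₀), 0 ≤ min (‖ζ‖ ^ p) (n : ℝ) := fun n ζ =>
    le_min (Real.rpow_nonneg (norm_nonneg _) p) n.cast_nonneg
  have hbound : ∀ n : ℕ, ∫ ω, min (‖S.X ξ (s + T) ω‖ ^ p) (n : ℝ) ∂P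
      ≤ 3 / 4 * ∫ ω, ‖S.X ξ s ω‖ ^ p ∂P + A := fun n => by
    rw [S.hMarkov (fun ζ => min (‖ζ‖ ^ p) (n : ℝ))
      ((measurable_norm.pow_const p).min measurable_const)
      ⟨n, fun ζ => by rw [abs_of_nonneg (hmin n ζ)]; exact min_le_right _ _⟩ s hs T hT.le ξ]
    have hInt := (hC ξ s ⟨hs, by linarith⟩).1
    have hrhs : ∫ ω, (3 / 4 * ‖S.X ξ s ω‖ ^ p + A) ∂P
        = 3 / 4 * ∫ ω, ‖S.X ξ s ω‖ ^ p ∂P + A := by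
      rw [integral_add (hInt.const_mul _) (integrable_const A), integral_const_mul]
      simp
    rw [← hrhs]
    refine integral_mono_of_nonneg (.of_forall fun ω => integral_nonneg fun ω' => hmin n _)
      ((hInt.const_mul _).add (integrable_const A)) (.of_forall fun ω => ?_)
    obtain ⟨C', -, hC'⟩ := S.exists_moment_le hp hT
    exact (integral_mono_of_nonneg (.of_forall fun ω' => hmin n _)
      (hC' (S.X ξ s ω) T ⟨hT.le, le_rfl⟩).1 (.of_forall fun ω' => min_le_left _ _)).trans (hA _)
  have hlim : Tendsto (fun n : ℕ => ∫ ω, min (‖S.X ξ (s + T) ω‖ ^ p) (n : ℝ) ∂P) atTop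
      (𝓝 (∫ ω, ‖S.X ξ (s + T) ω‖ ^ p ∂P)) := by
    refine tendsto_integral_of_dominated_convergence (fun ω => ‖S.X ξ (s + T) ω‖ ^ p)
      (fun n => (((S.measurable_norm_X ξ hsT.le).pow_const p).min
        measurable_const).aestronglyMeasurable) (hC ξ _ ⟨hsT.le, le_rfl⟩).1
      (fun n => .of_forall fun ω => ?_) (.of_forall fun ω => ?_)
    · rw [Real.norm_of_nonneg (hmin n _)]
      exact min_le_left _ _
    · refine tendsto_const_nhds.congr' ?_
      filter_upwards [eventually_ge_atTop ⌈‖S.X ξ (s + T) ω‖ ^ p⌉₊] with n hn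
      exact (min_eq_left (Nat.ceil_le.1 hn)).symm
  exact le_of_tendsto' hlim hbound

end Iteration

/-- **Lemma 3.1 (moment bound).** Under (A1)–(A3), for any `p ≥ 1` there exist
constants `c, β > 0` such that `E‖X_t^ξ‖_∞^p ≤ c(1 + e^{-βt}‖ξ‖_∞^p)` for all
`ξ ∈ 𝒞` and `t ≥ 0`. -/
theorem segment_moment_bound (S : PathSDE d r₀ Ω P) (p : ℝ) (hp : 1 ≤ p) :
    ∃ c β : ℝ, 0 < c ∧ 0 < β ∧
      ∀ (ξ : Seg d r₀), ∀ t ≥ (0:ℝ),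
        (∫ ω, ‖S.X ξ t ω‖ ^ p ∂P) ≤ c * (1 + Real.exp (-β * t) * ‖ξ‖ ^ p) := by
  have hp0 : 0 < p := one_pos.trans_le hp
  obtain ⟨T, A, hT, hA0, hA⟩ := S.exists_moment_contraction hp
  obtain ⟨C, hC, hmom⟩ := S.exists_moment_le hp0 hT
  set β : ℝ := Real.log (4 / 3) / T with hβ
  have hlog : 0 < Real.log (4 / 3) := Real.log_pos (by norm_num)
  have hβ0 : 0 < β := by positivity
  have hexpT : Real.exp (β * T) = 4 / 3 := by
    rw [hβ, div_mul_cancel₀ _ hT.ne', Real.exp_log (by norm_num)]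
  refine ⟨4 / 3 * C + 4 * A, β, by positivity, hβ0, fun ξ t ht => ?_⟩
  have hiter : ∀ (s : ℝ), 0 ≤ s → ∀ n : ℕ, ∫ ω, ‖S.X ξ (s + n * T) ω‖ ^ p ∂P
      ≤ (3 / 4) ^ n * ∫ ω, ‖S.X ξ s ω‖ ^ p ∂P + 4 * A := fun s hs n => by
    induction n with
    | zero => simpa using hA0.le
    | succ n ih =>
      have h := S.integral_norm_rpow_add_le hp0 hT hA ξ (show 0 ≤ s + n * T by positivity)
      rw [show s + ((n + 1 : ℕ) : ℝ) * T = s + n * T + T by push_cast; ring, pow_succ]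
      linarith
  set n : ℕ := ⌊t / T⌋₊ with hn
  have hn1 : n * T ≤ t := (le_div_iff₀ hT).1 (Nat.floor_le (by positivity))
  have hn2 : t < (n + 1) * T := (div_lt_iff₀ hT).1 (Nat.lt_floor_add_one _)
  have hb := hiter (t - n * T) (by linarith) n
  rw [sub_add_cancel] at hb
  have hm := (hmom ξ (t - n * T) ⟨by linarith, by linarith⟩).2
  have hy : 0 ≤ ‖ξ‖ ^ p := Real.rpow_nonneg (norm_nonneg _) p
  have hq : ((3 : ℝ) / 4) ^ n ≤ 4 / 3 * Real.exp (-β * t) := by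
    have h1 : (3 / 4 : ℝ) ^ n = Real.exp (-(n * (β * T))) := by
      rw [Real.exp_neg, Real.exp_nat_mul, hexpT, ← inv_pow]
      norm_num
    rw [h1, ← hexpT, ← Real.exp_add, Real.exp_le_exp]
    nlinarith
  have hq1 : ((3 : ℝ) / 4) ^ n ≤ 1 := pow_le_one₀ (by norm_num) (by norm_num)
  have he := Real.exp_pos (-β * t)
  calc ∫ ω, ‖S.X ξ t ω‖ ^ p ∂P ≤ (3 / 4) ^ n * (C * (1 + ‖ξ‖ ^ p)) + 4 * A :=
        hb.trans (by gcongr)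
    _ = (3 / 4) ^ n * C + (3 / 4) ^ n * (C * ‖ξ‖ ^ p) + 4 * A := by ring
    _ ≤ 1 * C + 4 / 3 * Real.exp (-β * t) * (C * ‖ξ‖ ^ p) + 4 * A := by gcongr
    _ ≤ (4 / 3 * C + 4 * A) * (1 + Real.exp (-β * t) * ‖ξ‖ ^ p) := by
        have h2 : 0 ≤ A * (Real.exp (-β * t) * ‖ξ‖ ^ p) := by positivity
        nlinarith
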